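/- Assume the DVV hypothesis stated in the context and define, for n ≥ 2 and u > 0, S_n(u) = Σ_{g≥0,k≥1, 2g−1+k=n, 2g−2+k>0} (1/k!)·Ω_{g,k}(w,…,w) with w = 1/(2u). Then for every integer n ≥ 3 and every u > 0: S_n′(u) = (1/(2·(2u)^{1/2}))·( −S_{n−1}″(u) + S_{n−1}′(u)/(2u) − Σ_{i+j=n, i,j≥2} S_i′(u)·S_j′(u) ). (These are exactly the order-ħⁿ WKB equations which, together with the verified equations at orders ħ⁰ through ħ³, show that Z = exp(Σ_{n≥0}ħ^{n−1}S_n) is annihilated by the quantized Airy curve operator (1/2)ħ²∂_u² − u.) -/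

import Mathlib

open Finset

/-- Real value of the double factorial `k‼` of an integer (with `k‼ = 1` for `k ≤ 0`,
in particular `(-1)‼ = 1`). -/
noncomputable def dfac (k : ℤ) : ℝ := (Nat.doubleFactorial k.toNat : ℝ)

/-- The rescaled correlator `⟨τ̃_{a_1} ⋯ τ̃_{a_n}⟩_g` with `τ̃_a = (2a+1)!! τ_a`. -/
noncomputable def ttau (τ : ℤ → (n : ℕ) → (Fin n → ℤ) → ℝ) (g : ℤ) (n : ℕ)
    (a : Fin n → ℤ) : ℝ :=
  (∏ i, dfac (2 * a i + 1)) * τ g n a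

/-- The DVV hypothesis: a symmetric family of correlators `⟨τ_{a_1} ⋯ τ_{a_n}⟩_g`,
vanishing unless `2g-2+n > 0`, all indices are nonnegative and `∑ aᵢ = 3g-3+n`
(in particular vanishing for `g < 0`), satisfying the Dijkgraaf–Verlinde–Verlinde
(Virasoro) recursion relations. -/
structure DVVFamily (τ : ℤ → (n : ℕ) → (Fin n → ℤ) → ℝ) : Prop where
  symm : ∀ (g : ℤ) (n : ℕ) (a : Fin n → ℤ) (σ : Equiv.Perm (Fin n)), τ g n (a ∘ σ) = τ g n a
  vanish : ∀ (g : ℤ) (n : ℕ) (a : Fin n → ℤ),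
      ¬((∀ i, 0 ≤ a i) ∧ 0 < 2 * g - 2 + (n : ℤ) ∧ (∑ i, a i) = 3 * g - 3 + n) → τ g n a = 0
  dvv : ∀ (g : ℤ) (n : ℕ), 0 ≤ g → 3 ≤ 2 * g + (n : ℤ) → ∀ (a₀ : ℤ) (a : Fin n → ℤ),
      0 ≤ a₀ → (∀ i, 0 ≤ a i) →
      ttau τ g (n + 1) (Fin.cons a₀ a) =
        (∑ i, (2 * (a i : ℝ) + 1) * ttau τ g n (Function.update a i (a₀ + a i - 1)))
        + (1 / 2) * ∑ b₁ ∈ Finset.Icc (0 : ℤ) (a₀ - 2),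
            (ttau τ (g - 1) (n + 2) (Fin.cons b₁ (Fin.cons (a₀ - 2 - b₁) a))
             + ∑ g₁ ∈ Finset.Icc (0 : ℤ) g, ∑ A ∈ (univ : Finset (Fin n)).powerset,
                if 0 < 2 * g₁ - 1 + (A.card : ℤ) ∧ 0 < 2 * (g - g₁) - 1 + ((Aᶜ).card : ℤ) then
                  ttau τ g₁ (A.card + 1) (Fin.cons b₁ (fun j => a (A.orderIsoOfFin rfl j).1))
                  * ttau τ (g - g₁) ((Aᶜ).card + 1)
                      (Fin.cons (a₀ - 2 - b₁) (fun j => a ((Aᶜ).orderIsoOfFin rfl j).1))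
                else 0)

/-- The antiderivative generating function
`Ω_{g,n}(w_1,…,w_n) = ∑ ⟨τ_{a_1}⋯τ_{a_n}⟩_g ∏ (2aᵢ-1)!! wᵢ^{aᵢ+1/2}` (with `(-1)!! = 1`),
written as a finite sum over `0 ≤ aᵢ ≤ 3g-3+n`. -/
noncomputable def OmegaF (τ : ℤ → (n : ℕ) → (Fin n → ℤ) → ℝ) (g : ℤ) (n : ℕ)
    (w : Fin n → ℝ) : ℝ :=
  ∑ a : Fin n → Fin ((3 * g + n - 3).toNat + 1),
    τ g n (fun i => ((a i : ℕ) : ℤ))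
      * ∏ i, dfac (2 * ((a i : ℕ) : ℤ) - 1) * w i ^ (((a i : ℕ) : ℝ) + 1 / 2)

/-- `S_n(u) = Σ_{g≥0,k≥1, 2g-1+k=n, (g,k) stable} (1/k!) Ω_{g,k}(w,…,w)` with `w = 1/(2u)`;
for `n ≥ 2` the stable pairs are exactly `(g, k)` with `k = (n-2g)+1` and `2g ≤ n`. -/
noncomputable def Sfun (τ : ℤ → (n : ℕ) → (Fin n → ℤ) → ℝ) (n : ℕ) (u : ℝ) : ℝ :=
  ∑ g ∈ Finset.range (n + 1),
    if 2 * g ≤ n then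
      (1 / (Nat.factorial (n - 2 * g + 1) : ℝ))
        * OmegaF τ g ((n - 2 * g) + 1) (fun _ => 1 / (2 * u))
    else 0

/-- A tuple of bounded indices, viewed as a tuple of integers. -/
def boxVal {N k : ℕ} (a : Fin k → Fin N) : Fin k → ℤ := fun i => ((a i : ℕ) : ℤ)

/-- The weight `∏ (2 aᵢ + 1)⁻¹`. -/
noncomputable def boxWt {N k : ℕ} (a : Fin k → Fin N) : ℝ := ∏ i, (2 * ((a i : ℕ) : ℝ) + 1)⁻¹

/-- The fully integrated specialization of the rescaled correlators. -/
noncomputable def corrSum (τ : ℤ → (n : ℕ) → (Fin n → ℤ) → ℝ) (N : ℕ) (g : ℤ) (k : ℕ) : ℝ :=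
  ∑ a : Fin k → Fin N, boxWt a * ttau τ g k (boxVal a)

/-- The specialization with one differentiated insertion. -/
noncomputable def corrSumOne (τ : ℤ → (n : ℕ) → (Fin n → ℤ) → ℝ) (N : ℕ) (g : ℤ) (k : ℕ) : ℝ :=
  ∑ a : Fin k → Fin N, boxWt a * ∑ b : Fin N, ttau τ g (k + 1) (Fin.cons ((b : ℕ) : ℤ) (boxVal a))

/-- The specialization with one insertion differentiated twice. -/
noncomputable def corrSumTwice (τ : ℤ → (n : ℕ) → (Fin n → ℤ) → ℝ) (N : ℕ) (g : ℤ) (k : ℕ) : ℝ :=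
  ∑ a : Fin k → Fin N, boxWt a * ∑ b : Fin N,
    (2 * ((b : ℕ) : ℝ) + 1) * ttau τ g (k + 1) (Fin.cons ((b : ℕ) : ℤ) (boxVal a))

/-- The specialization with two differentiated insertions. -/
noncomputable def corrSumPair (τ : ℤ → (n : ℕ) → (Fin n → ℤ) → ℝ) (N : ℕ) (g : ℤ) (k : ℕ) : ℝ :=
  ∑ a : Fin k → Fin N, boxWt a * ∑ b : Fin N, ∑ c : Fin N,
    ttau τ g (k + 2) (Fin.cons ((b : ℕ) : ℤ) (Fin.cons ((c : ℕ) : ℤ) (boxVal a)))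

theorem sum_fin_cons {X : Type*} [Fintype X] {k : ℕ} (f : (Fin (k + 1) → X) → ℝ) :
    ∑ a, f a = ∑ a : Fin k → X, ∑ b : X, f (Fin.cons b a) := by
  rw [← (Fin.consEquiv (fun _ : Fin (k + 1) => X)).sum_comp, Fintype.sum_prod_type,
    Finset.sum_comm]
  rfl

theorem sum_sum_eq_of_swap {X : Type*} [Fintype X] {k : ℕ}
    (f : Fin (k + 1) → (Fin (k + 1) → X) → ℝ)
    (hf : ∀ i a, f i (a ∘ Equiv.swap 0 i) = f 0 a) :
    ∑ a, ∑ i, f i a = (k + 1) * ∑ a, f 0 a := by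
  rw [Finset.sum_comm]
  have : ∀ i, ∑ a, f i a = ∑ a, f 0 a := fun i => by
    rw [← ((Equiv.swap 0 i).arrowCongr (Equiv.refl X)).sum_comp]
    exact Finset.sum_congr rfl fun a _ => hf i a
  simp [this]

theorem boxVal_cons {N k : ℕ} (b : Fin N) (a : Fin k → Fin N) :
    boxVal (Fin.cons b a : Fin (k + 1) → Fin N) = Fin.cons ((b : ℕ) : ℤ) (boxVal a) := by
  funext i
  refine Fin.cases ?_ (fun j => ?_) i <;> simp [boxVal]

theorem boxWt_cons {N k : ℕ} (b : Fin N) (a : Fin k → Fin N) :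
    boxWt (Fin.cons b a : Fin (k + 1) → Fin N) = (2 * ((b : ℕ) : ℝ) + 1)⁻¹ * boxWt a := by
  rw [boxWt, Fin.prod_univ_succ]
  simp [boxWt]

theorem boxWt_comp {N k : ℕ} (a : Fin k → Fin N) (σ : Equiv.Perm (Fin k)) :
    boxWt (a ∘ σ) = boxWt a :=
  Equiv.prod_comp σ fun i => (2 * ((a i : ℕ) : ℝ) + 1)⁻¹

theorem boxVal_nonneg {N k : ℕ} (a : Fin k → Fin N) (i : Fin k) : 0 ≤ boxVal a i := by
  simp [boxVal]

theorem two_mul_add_one_ne_zero (m : ℕ) : (2 * (m : ℝ) + 1) ≠ 0 := by positivity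

section

variable {τ : ℤ → (n : ℕ) → (Fin n → ℤ) → ℝ}

theorem DVVFamily.ttau_comp (h : DVVFamily τ) (g : ℤ) {n : ℕ} (a : Fin n → ℤ)
    (σ : Equiv.Perm (Fin n)) : ttau τ g n (a ∘ σ) = ttau τ g n a := by
  unfold ttau
  rw [h.symm, ← Equiv.prod_comp σ fun i => dfac (2 * a i + 1)]
  rfl

theorem cons_comp_perm {X : Type*} {n : ℕ} (b : X) (a : Fin n → X) (σ : Equiv.Perm (Fin n)) :
    (Fin.cons b (a ∘ σ) : Fin (n + 1) → X) =
      (Fin.cons b a : Fin (n + 1) → X) ∘ Equiv.Perm.decomposeFin.symm (0, σ) := by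
  funext i
  refine Fin.cases ?_ (fun j => ?_) i
  · simp
  · simp [Equiv.Perm.decomposeFin_symm_apply_succ]

theorem DVVFamily.ttau_cons_comp (h : DVVFamily τ) (g : ℤ) {n : ℕ} (b : ℤ) (a : Fin n → ℤ)
    (σ : Equiv.Perm (Fin n)) :
    ttau τ g (n + 1) (Fin.cons b (a ∘ σ)) = ttau τ g (n + 1) (Fin.cons b a) := by
  rw [cons_comp_perm, h.ttau_comp]

theorem DVVFamily.ttau_eq_zero_of_sum_ne (h : DVVFamily τ) (g : ℤ) {n : ℕ} (a : Fin n → ℤ)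
    (ha : ∑ i, a i ≠ 3 * g - 3 + n) : ttau τ g n a = 0 := by
  rw [ttau, h.vanish g n a (fun hc => ha hc.2.2), mul_zero]

theorem DVVFamily.ttau_eq_zero_of_neg (h : DVVFamily τ) (g : ℤ) {n : ℕ} (a : Fin n → ℤ)
    (i : Fin n) (ha : a i < 0) : ttau τ g n a = 0 := by
  rw [ttau, h.vanish g n a (fun hc => absurd (hc.1 i) (not_le.2 ha)), mul_zero]

theorem DVVFamily.sum_mul_ttau (h : DVVFamily τ) (g : ℤ) {n : ℕ} (a : Fin n → ℤ) :
    (∑ i, (2 * (a i : ℝ) + 1)) * ttau τ g n a = (6 * g - 6 + 3 * n) * ttau τ g n a := by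
  by_cases ha : ∑ i, a i = 3 * g - 3 + n
  · congr 1
    have : (∑ i, (a i : ℝ)) = 3 * g - 3 + n := by exact_mod_cast congrArg (Int.cast : ℤ → ℝ) ha
    rw [Finset.sum_add_distrib, ← Finset.mul_sum, this]
    simp
    ring
  · simp [h.ttau_eq_zero_of_sum_ne g a ha]

theorem DVVFamily.corrSum_succ (h : DVVFamily τ) (N : ℕ) (g : ℤ) (k : ℕ) :
    (k + 1) * corrSumOne τ N g k = (6 * g - 6 + 3 * (k + 1)) * corrSum τ N g (k + 1) := by
  have key := sum_sum_eq_of_swap (X := Fin N) (k := k)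
    (fun i a => (2 * ((a i : ℕ) : ℝ) + 1) * (boxWt a * ttau τ g (k + 1) (boxVal a)))
    (fun i a => by
      have : boxVal (a ∘ Equiv.swap 0 i) = boxVal a ∘ Equiv.swap 0 i := rfl
      simp only [boxWt_comp, this, h.ttau_comp]
      simp)
  rw [corrSum, corrSumOne, Finset.mul_sum (a := (6 * g - 6 + 3 * (k + 1) : ℝ))]
  rw [sum_fin_cons (X := Fin N) (f := fun a => (2 * ((a 0 : ℕ) : ℝ) + 1) *
    (boxWt a * ttau τ g (k + 1) (boxVal a)))] at key
  convert key.symm using 2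
  · refine Finset.sum_congr rfl fun a _ => ?_
    rw [Finset.mul_sum]
    refine Finset.sum_congr rfl fun b _ => ?_
    rw [boxWt_cons, boxVal_cons, Fin.cons_zero]
    field_simp [two_mul_add_one_ne_zero]
  · rename_i a _
    rw [← Finset.sum_mul]
    have := h.sum_mul_ttau g (boxVal a)
    simp only [boxVal, Int.cast_natCast] at this ⊢
    push_cast at this
    linear_combination -boxWt a * this

theorem DVVFamily.corrSumOne_zero (h : DVVFamily τ) (N : ℕ) (g : ℤ) :
    corrSumTwice τ N g 0 = (6 * g - 6 + 3) * corrSumOne τ N g 0 := by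
  rw [corrSumTwice, corrSumOne, Finset.mul_sum]
  refine Finset.sum_congr rfl fun a _ => ?_
  rw [mul_left_comm, Finset.mul_sum (a := (6 * g - 6 + 3 : ℝ))]
  congr 1
  refine Finset.sum_congr rfl fun b _ => ?_
  simpa using h.sum_mul_ttau g (Fin.cons ((b : ℕ) : ℤ) (boxVal a))

theorem DVVFamily.corrSumOne_succ (h : DVVFamily τ) (N : ℕ) (g : ℤ) (k : ℕ) :
    corrSumTwice τ N g (k + 1) + (k + 1) * corrSumPair τ N g k =
      (6 * g - 6 + 3 * (k + 2)) * corrSumOne τ N g (k + 1) := by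
  have key := sum_sum_eq_of_swap (X := Fin N) (k := k)
    (fun i a => (2 * ((a i : ℕ) : ℝ) + 1) * (boxWt a *
      ∑ b : Fin N, ttau τ g (k + 2) (Fin.cons ((b : ℕ) : ℤ) (boxVal a))))
    (fun i a => by
      have : boxVal (a ∘ Equiv.swap 0 i) = boxVal a ∘ Equiv.swap 0 i := rfl
      simp only [boxWt_comp, this, h.ttau_cons_comp]
      simp)
  rw [sum_fin_cons (X := Fin N) (f := fun a => (2 * ((a 0 : ℕ) : ℝ) + 1) * (boxWt a *
      ∑ b : Fin N, ttau τ g (k + 2) (Fin.cons ((b : ℕ) : ℤ) (boxVal a))))] at key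
  have hpair : corrSumPair τ N g k = ∑ a : Fin k → Fin N, ∑ b : Fin N,
      (2 * (((Fin.cons b a : Fin (k + 1) → Fin N) 0 : ℕ) : ℝ) + 1) *
      (boxWt (Fin.cons b a : Fin (k + 1) → Fin N) *
      ∑ c : Fin N, ttau τ g (k + 2) (Fin.cons ((c : ℕ) : ℤ)
        (boxVal (Fin.cons b a : Fin (k + 1) → Fin N)))) := by
    refine Finset.sum_congr rfl fun a _ => ?_
    rw [Finset.sum_comm, Finset.mul_sum]
    refine Finset.sum_congr rfl fun b _ => ?_
    rw [boxWt_cons, boxVal_cons, Fin.cons_zero]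
    field_simp [two_mul_add_one_ne_zero]
  rw [hpair, ← key, corrSumTwice, corrSumOne, ← Finset.sum_add_distrib, Finset.mul_sum]
  refine Finset.sum_congr rfl fun a _ => ?_
  rw [← Finset.sum_mul, mul_left_comm, ← mul_add, mul_left_comm, Finset.mul_sum, Finset.mul_sum,
    ← Finset.sum_add_distrib]
  congr 1
  refine Finset.sum_congr rfl fun b _ => ?_
  have := h.sum_mul_ttau g (Fin.cons ((b : ℕ) : ℤ) (boxVal a))
  rw [Fin.sum_univ_succ] at this
  simp only [Fin.cons_zero, Fin.cons_succ, Int.cast_natCast, boxVal] at this ⊢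
  push_cast at this
  linear_combination this

theorem sum_fin_ite_eq (N : ℕ) (x : ℤ) (r : ℝ) :
    ∑ c : Fin N, (if ((c : ℕ) : ℤ) = x then r else 0) = if 0 ≤ x ∧ x < N then r else 0 := by
  split_ifs with hx
  · lift x to ℕ using hx.1
    rw [Finset.sum_eq_single (⟨x, by exact_mod_cast hx.2⟩ : Fin N)]
    · simp
    · intro b _ hb
      rw [if_neg]
      intro hbx
      exact hb (Fin.ext (by exact_mod_cast hbx))
    · simp
  · refine Finset.sum_eq_zero fun c _ => if_neg fun hc => hx ?_
    have := c.2
    omega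

theorem sum_fin_sum_fin_add_sub_one (N : ℕ) (f : ℤ → ℝ) (hneg : ∀ x < 0, f x = 0)
    (hbig : ∀ x, (N : ℤ) ≤ x + 1 → f x = 0) :
    ∑ b : Fin N, ∑ c : Fin N, f (((b : ℕ) : ℤ) + ((c : ℕ) : ℤ) - 1) =
      ∑ b : Fin N, (((b : ℕ) : ℝ) + 2) * f ((b : ℕ) : ℤ) := by
  have h1 : ∀ b c : Fin N, f (((b : ℕ) : ℤ) + ((c : ℕ) : ℤ) - 1) = ∑ d : Fin N,
      if ((c : ℕ) : ℤ) = (d : ℕ) + 1 - (b : ℕ) then f ((d : ℕ) : ℤ) else 0 := by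
    intro b c
    have h2 : ∀ d : Fin N, (if ((c : ℕ) : ℤ) = (d : ℕ) + 1 - (b : ℕ) then f ((d : ℕ) : ℤ) else 0) =
        if ((d : ℕ) : ℤ) = (b : ℕ) + (c : ℕ) - 1 then f (((b : ℕ) : ℤ) + (c : ℕ) - 1) else 0 := by
      intro d
      by_cases hd : ((d : ℕ) : ℤ) = (b : ℕ) + (c : ℕ) - 1
      · rw [if_pos hd, if_pos (by omega), hd]
      · rw [if_neg hd, if_neg (by omega)]
    rw [Finset.sum_congr rfl fun d _ => h2 d, sum_fin_ite_eq]
    split_ifs with hx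
    · rfl
    · by_cases h0 : ((b : ℕ) : ℤ) + (c : ℕ) - 1 < 0
      · exact hneg _ h0
      · exact hbig _ (by omega)
  simp only [h1]
  rw [Finset.sum_congr rfl fun b _ => Finset.sum_comm, Finset.sum_comm]
  refine Finset.sum_congr rfl fun d _ => ?_
  by_cases hd : (d : ℕ) + 1 < N
  · have h3 : ∀ b : Fin N, (∑ c : Fin N,
        if ((c : ℕ) : ℤ) = (d : ℕ) + 1 - (b : ℕ) then f ((d : ℕ) : ℤ) else 0) =
        if (b : ℕ) < (d : ℕ) + 2 then f ((d : ℕ) : ℤ) else 0 := by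
      intro b
      rw [sum_fin_ite_eq]
      refine if_congr ?_ rfl rfl
      omega
    rw [Finset.sum_congr rfl fun b _ => h3 b,
      Finset.sum_range (n := N) (f := fun b => if b < (d : ℕ) + 2 then f ((d : ℕ) : ℤ) else 0) |>.symm,
      ← Finset.sum_filter]
    have : (Finset.range N).filter (fun b => b < (d : ℕ) + 2) = Finset.range ((d : ℕ) + 2) := by
      ext b
      simp only [Finset.mem_filter, Finset.mem_range]
      omega
    simp [this]
  · rw [hbig _ (by omega)]
    simp

theorem sum_fin_sum_Icc (N : ℕ) (G : ℤ → ℤ → ℝ)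
    (hG : ∀ b c : ℕ, N ≤ b + c + 2 → G b c = 0) :
    ∑ d : Fin N, ∑ b ∈ Finset.Icc (0 : ℤ) (((d : ℕ) : ℤ) - 2), G b (((d : ℕ) : ℤ) - 2 - b) =
      ∑ b : Fin N, ∑ c : Fin N, G ((b : ℕ) : ℤ) ((c : ℕ) : ℤ) := by
  have h1 : ∀ b c : Fin N, G ((b : ℕ) : ℤ) ((c : ℕ) : ℤ) = ∑ d : Fin N,
      if ((c : ℕ) : ℤ) = (d : ℕ) - 2 - (b : ℕ) then
        G ((b : ℕ) : ℤ) (((d : ℕ) : ℤ) - 2 - (b : ℕ)) else 0 := by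
    intro b c
    have h2 : ∀ d : Fin N, (if ((c : ℕ) : ℤ) = (d : ℕ) - 2 - (b : ℕ) then
        G ((b : ℕ) : ℤ) (((d : ℕ) : ℤ) - 2 - (b : ℕ)) else 0) =
        if ((d : ℕ) : ℤ) = (b : ℕ) + (c : ℕ) + 2 then G ((b : ℕ) : ℤ) ((c : ℕ) : ℤ) else 0 := by
      intro d
      by_cases hd : ((d : ℕ) : ℤ) = (b : ℕ) + (c : ℕ) + 2
      · have hc : ((c : ℕ) : ℤ) = (d : ℕ) - 2 - (b : ℕ) := by omega
        rw [if_pos hd, if_pos hc, ← hc]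
      · rw [if_neg hd, if_neg (by omega)]
    rw [Finset.sum_congr rfl fun d _ => h2 d, sum_fin_ite_eq]
    split_ifs with hx
    · rfl
    · exact hG _ _ (by omega)
  simp only [h1]
  rw [Finset.sum_congr rfl fun b _ => Finset.sum_comm, Finset.sum_comm]
  refine Finset.sum_congr rfl fun d _ => ?_
  have h4 : ∀ x ∈ Finset.Icc (0 : ℤ) (((d : ℕ) : ℤ) - 2), G x (((d : ℕ) : ℤ) - 2 - x) =
      ∑ b : Fin N, if ((b : ℕ) : ℤ) = x then G x (((d : ℕ) : ℤ) - 2 - x) else 0 := by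
    intro x hx
    rw [Finset.mem_Icc] at hx
    rw [sum_fin_ite_eq, if_pos (by omega)]
  rw [Finset.sum_congr rfl h4, Finset.sum_comm]
  refine Finset.sum_congr rfl fun b _ => ?_
  rw [sum_fin_ite_eq, Finset.sum_ite_eq]
  refine if_congr ?_ rfl rfl
  rw [Finset.mem_Icc]
  omega

theorem sum_boxWt_mul_split {N k : ℕ} (A : Finset (Fin k)) (F : (Fin A.card → Fin N) → ℝ)
    (G : (Fin Aᶜ.card → Fin N) → ℝ) :
    ∑ a : Fin k → Fin N, boxWt a * (F (fun j => a (A.orderIsoOfFin rfl j).1) *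
      G (fun j => a (Aᶜ.orderIsoOfFin rfl j).1)) =
      (∑ a, boxWt a * F a) * ∑ a, boxWt a * G a := by
  let e : Fin A.card ⊕ Fin Aᶜ.card ≃ Fin k := finSumEquivOfFinset rfl rfl
  have el : ∀ j, (A.orderIsoOfFin rfl j).1 = e (Sum.inl j) := fun j => by
    rw [finSumEquivOfFinset_inl, Finset.coe_orderIsoOfFin_apply]
  have er : ∀ j, (Aᶜ.orderIsoOfFin rfl j).1 = e (Sum.inr j) := fun j => by
    rw [finSumEquivOfFinset_inr, Finset.coe_orderIsoOfFin_apply]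
  simp only [el, er]
  rw [← ((Equiv.sumArrowEquivProdArrow _ _ (Fin N)).symm.trans
    (e.arrowCongr (Equiv.refl (Fin N)))).sum_comp, Fintype.sum_prod_type, Finset.sum_mul_sum]
  refine Finset.sum_congr rfl fun p _ => Finset.sum_congr rfl fun q _ => ?_
  have hw : boxWt (((Equiv.sumArrowEquivProdArrow _ _ (Fin N)).symm.trans
      (e.arrowCongr (Equiv.refl (Fin N)))) (p, q)) = boxWt p * boxWt q := by
    rw [boxWt, ← Equiv.prod_comp e, Fintype.prod_sum_type]
    simp [boxWt, Equiv.arrowCongr]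
  rw [hw]
  simp only [Equiv.arrowCongr, Equiv.trans_apply, Equiv.coe_fn_mk, Function.comp_apply,
    Equiv.symm_apply_apply, Equiv.refl_apply]
  simp only [Equiv.sumArrowEquivProdArrow_symm_apply_inl,
    Equiv.sumArrowEquivProdArrow_symm_apply_inr]
  ring

theorem DVVFamily.sum_update (h : DVVFamily τ) (N : ℕ) (g : ℤ) (k : ℕ)
    (hN : 3 * g + k < N + 2) :
    ∑ a : Fin k → Fin N, boxWt a * ∑ b : Fin N, ∑ i, (2 * (boxVal a i : ℝ) + 1) *
      ttau τ g k (Function.update (boxVal a) i (((b : ℕ) : ℤ) + boxVal a i - 1)) =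
      k * (1 / 2 * corrSumTwice τ N g (k - 1) + 3 / 2 * corrSumOne τ N g (k - 1)) := by
  obtain _ | k := k
  · simp
  have key := sum_sum_eq_of_swap (X := Fin N) (k := k)
    (fun i a => boxWt a * ∑ b : Fin N, (2 * (boxVal a i : ℝ) + 1) *
      ttau τ g (k + 1) (Function.update (boxVal a) i (((b : ℕ) : ℤ) + boxVal a i - 1)))
    (fun i a => by
      have : boxVal (a ∘ Equiv.swap 0 i) = boxVal a ∘ Equiv.swap 0 i := rfl
      have hu : ∀ x, Function.update (boxVal a ∘ Equiv.swap 0 i) i x =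
          Function.update (boxVal a) 0 x ∘ Equiv.swap 0 i := fun x => by
        rw [Function.update_comp_equiv]
        simp
      simp only [boxWt_comp, this, hu, h.ttau_comp]
      simp)
  simp only [← Finset.mul_sum] at key
  rw [sum_fin_cons (X := Fin N) (f := fun a => boxWt a * ((2 * (boxVal a 0 : ℝ) + 1) *
    ∑ b : Fin N, ttau τ g (k + 1)
      (Function.update (boxVal a) 0 (((b : ℕ) : ℤ) + boxVal a 0 - 1))))] at key
  have hswap : ∀ a : Fin (k + 1) → Fin N, (∑ b : Fin N, ∑ i, (2 * (boxVal a i : ℝ) + 1) *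
      ttau τ g (k + 1) (Function.update (boxVal a) i (((b : ℕ) : ℤ) + boxVal a i - 1))) =
      ∑ i, (2 * (boxVal a i : ℝ) + 1) * ∑ b : Fin N,
      ttau τ g (k + 1) (Function.update (boxVal a) i (((b : ℕ) : ℤ) + boxVal a i - 1)) := by
    intro a
    rw [Finset.sum_comm]
    simp only [Finset.mul_sum]
  simp only [hswap]
  rw [key]
  push_cast
  congr 1
  rw [corrSumTwice, corrSumOne, Finset.mul_sum, Finset.mul_sum,
    ← Finset.sum_add_distrib]
  refine Finset.sum_congr rfl fun a _ => ?_
  have hs := sum_fin_sum_fin_add_sub_one N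
    (fun x => ttau τ g (k + 1) (Fin.cons x (boxVal a)))
    (fun x hx => h.ttau_eq_zero_of_neg g _ 0 (by simpa using hx))
    (fun x hx => h.ttau_eq_zero_of_sum_ne g _ (by
      rw [Fin.sum_univ_succ]
      simp only [Fin.cons_zero, Fin.cons_succ]
      have := Finset.sum_nonneg (s := Finset.univ) fun i _ => boxVal_nonneg a i
      push_cast at hN ⊢
      omega))
  rw [Finset.sum_comm] at hs
  have e1 : ∀ c : Fin N, boxWt (Fin.cons c a : Fin (k + 1) → Fin N) *
      ((2 * (boxVal (Fin.cons c a : Fin (k + 1) → Fin N) 0 : ℝ) + 1) * ∑ b : Fin N,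
      ttau τ g (k + 1) (Function.update (boxVal (Fin.cons c a : Fin (k + 1) → Fin N)) 0
        (((b : ℕ) : ℤ) + boxVal (Fin.cons c a : Fin (k + 1) → Fin N) 0 - 1))) =
      boxWt a * ∑ b : Fin N, ttau τ g (k + 1)
        (Fin.cons (((b : ℕ) : ℤ) + ((c : ℕ) : ℤ) - 1) (boxVal a)) := by
    intro c
    rw [boxWt_cons, boxVal_cons, Fin.cons_zero]
    simp only [Fin.update_cons_zero, Int.cast_natCast]
    field_simp [two_mul_add_one_ne_zero]
  have e2 : ∑ b : Fin N, (((b : ℕ) : ℝ) + 2) *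
      ttau τ g (k + 1) (Fin.cons ((b : ℕ) : ℤ) (boxVal a)) =
      1 / 2 * ∑ b : Fin N, (2 * ((b : ℕ) : ℝ) + 1) *
        ttau τ g (k + 1) (Fin.cons ((b : ℕ) : ℤ) (boxVal a)) +
      3 / 2 * ∑ b : Fin N, ttau τ g (k + 1) (Fin.cons ((b : ℕ) : ℤ) (boxVal a)) := by
    rw [Finset.mul_sum, Finset.mul_sum, ← Finset.sum_add_distrib]
    exact Finset.sum_congr rfl fun _ _ => by ring
  rw [Finset.sum_congr rfl fun c _ => e1 c, ← Finset.mul_sum, hs, e2]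
  ring

theorem sum_cons_boxVal_ge {N k : ℕ} (b : ℕ) (a : Fin k → Fin N) :
    (b : ℤ) ≤ ∑ i, (Fin.cons (b : ℤ) (boxVal a) : Fin (k + 1) → ℤ) i := by
  rw [Fin.sum_univ_succ]
  simpa using Finset.sum_nonneg fun i _ => boxVal_nonneg a i

theorem sum_int_Icc_zero (g : ℕ) (f : ℤ → ℝ) :
    ∑ x ∈ Finset.Icc (0 : ℤ) g, f x = ∑ x ∈ Finset.range (g + 1), f x := by
  symm
  refine Finset.sum_nbij' (fun x => (x : ℤ)) Int.toNat ?_ ?_ ?_ ?_ ?_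
  · intro x hx
    simp only [Finset.mem_range, Finset.mem_Icc] at *
    omega
  · intro x hx
    simp only [Finset.mem_range, Finset.mem_Icc] at *
    omega
  · simp
  · intro x hx
    simp only [Finset.mem_Icc] at *
    omega
  · simp

theorem DVVFamily.corrSumOne_rec (h : DVVFamily τ) (N g k : ℕ) (hN : 3 * g + k ≤ N)
    (hgk : 3 ≤ 2 * g + k) :
    corrSumOne τ N g k =
      k * (1 / 2 * corrSumTwice τ N g (k - 1) + 3 / 2 * corrSumOne τ N g (k - 1)) +
      1 / 2 * (corrSumPair τ N (g - 1) k +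
        ∑ g₁ ∈ Finset.range (g + 1), ∑ m ∈ Finset.range (k + 1), (k.choose m : ℝ) *
          if 2 ≤ 2 * g₁ + m ∧ 2 ≤ 2 * (g - g₁) + (k - m) then
            corrSumOne τ N g₁ m * corrSumOne τ N (g - g₁ : ℕ) (k - m) else 0) := by
  have hd : ∀ (a : Fin k → Fin N) (b : Fin N), _ := fun a b =>
    h.dvv g k (by omega) (by exact_mod_cast hgk) ((b : ℕ) : ℤ) (boxVal a) (by omega)
      (boxVal_nonneg a)
  rw [corrSumOne]
  simp only [hd]
  clear hd
  simp only [Finset.sum_add_distrib (ι := Fin N), mul_add (boxWt _), ← Finset.mul_sum]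
  rw [Finset.sum_add_distrib, h.sum_update N g k (by omega)]
  congr 1
  have hconv : ∀ a : Fin k → Fin N, _ := fun a => sum_fin_sum_Icc N
    (fun b c => ttau τ (g - 1) (k + 2) (Fin.cons b (Fin.cons c (boxVal a)))
      + ∑ g₁ ∈ Finset.Icc (0 : ℤ) g, ∑ A ∈ (univ : Finset (Fin k)).powerset,
        if 0 < 2 * g₁ - 1 + (A.card : ℤ) ∧ 0 < 2 * (g - g₁) - 1 + ((Aᶜ).card : ℤ) then
          ttau τ g₁ (A.card + 1) (Fin.cons b (fun j => boxVal a (A.orderIsoOfFin rfl j).1))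
          * ttau τ (g - g₁) ((Aᶜ).card + 1)
              (Fin.cons c (fun j => boxVal a ((Aᶜ).orderIsoOfFin rfl j).1))
        else 0) (by
    intro b c hbc
    rw [h.ttau_eq_zero_of_sum_ne, zero_add]
    · refine Finset.sum_eq_zero fun g₁ _ => Finset.sum_eq_zero fun A _ => ?_
      split_ifs with hs
      · by_contra hne
        have h1 := not_imp_comm.1 (h.ttau_eq_zero_of_sum_ne _ _) (left_ne_zero_of_mul hne)
        have h2 := not_imp_comm.1 (h.ttau_eq_zero_of_sum_ne _ _) (right_ne_zero_of_mul hne)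
        have h3 := sum_cons_boxVal_ge b fun j => a (A.orderIsoOfFin rfl j).1
        have h4 := sum_cons_boxVal_ge c fun j => a (Aᶜ.orderIsoOfFin rfl j).1
        have h5 := Finset.card_add_card_compl A
        rw [Fintype.card_fin] at h5
        have h6 := h3.trans_eq h1
        have h7 := h4.trans_eq h2
        push_cast at h6 h7
        omega
      · rfl
    · have h3 := sum_cons_boxVal_ge c a
      rw [Fin.sum_univ_succ]
      simp only [Fin.cons_zero, Fin.cons_succ]
      push_cast
      omega)
  simp only [mul_left_comm (boxWt _) (1 / 2 : ℝ), ← Finset.mul_sum]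
  congr 1
  rw [Finset.sum_congr rfl fun a _ => congrArg (boxWt a * ·) (hconv a)]
  simp only [Finset.sum_add_distrib (ι := Fin N), mul_add (boxWt _)]
  rw [Finset.sum_add_distrib]
  congr 1
  have hpull : ∀ a : Fin k → Fin N, (boxWt a * ∑ b : Fin N, ∑ c : Fin N,
      ∑ g₁ ∈ Finset.Icc (0 : ℤ) g, ∑ A ∈ (univ : Finset (Fin k)).powerset,
        if 0 < 2 * g₁ - 1 + (A.card : ℤ) ∧ 0 < 2 * (g - g₁) - 1 + ((Aᶜ).card : ℤ) then
          ttau τ g₁ (A.card + 1)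
            (Fin.cons ((b : ℕ) : ℤ) (fun j => boxVal a (A.orderIsoOfFin rfl j).1))
          * ttau τ (g - g₁) ((Aᶜ).card + 1)
              (Fin.cons ((c : ℕ) : ℤ) (fun j => boxVal a ((Aᶜ).orderIsoOfFin rfl j).1))
        else 0) = ∑ g₁ ∈ Finset.range (g + 1), ∑ A ∈ (univ : Finset (Fin k)).powerset,
        if 2 ≤ 2 * g₁ + A.card ∧ 2 ≤ 2 * (g - g₁) + (k - A.card) then
          boxWt a * ((∑ b : Fin N, ttau τ g₁ (A.card + 1)
            (Fin.cons ((b : ℕ) : ℤ) (boxVal fun j => a (A.orderIsoOfFin rfl j).1)))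
          * ∑ c : Fin N, ttau τ (g - g₁ : ℕ) ((Aᶜ).card + 1)
              (Fin.cons ((c : ℕ) : ℤ) (boxVal fun j => a ((Aᶜ).orderIsoOfFin rfl j).1)))
        else 0 := by
    intro a
    simp only [Finset.sum_comm (s := (Finset.univ : Finset (Fin N)))
      (t := Finset.Icc (0 : ℤ) (g : ℤ)), Finset.sum_comm (s := (Finset.univ : Finset (Fin N)))
      (t := (univ : Finset (Fin k)).powerset)]
    rw [sum_int_Icc_zero, Finset.mul_sum]
    refine Finset.sum_congr rfl fun g₁ hg₁ => ?_
    rw [Finset.mul_sum]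
    refine Finset.sum_congr rfl fun A _ => ?_
    rw [Finset.mem_range] at hg₁
    have h5 := Finset.card_add_card_compl A
    rw [Fintype.card_fin] at h5
    have hgg : ((g - g₁ : ℕ) : ℤ) = (g : ℤ) - g₁ := by omega
    have hc : (0 < 2 * (g₁ : ℤ) - 1 + (A.card : ℤ) ∧
        0 < 2 * ((g : ℤ) - g₁) - 1 + ((Aᶜ).card : ℤ)) ↔
        (2 ≤ 2 * g₁ + A.card ∧ 2 ≤ 2 * (g - g₁) + (k - A.card)) := by omega
    rw [hgg]
    simp only [hc]
    split_ifs
    · rw [Finset.sum_mul_sum]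
      rfl
    · simp
  rw [Finset.sum_congr rfl fun a _ => hpull a, Finset.sum_comm]
  refine Finset.sum_congr rfl fun g₁ _ => ?_
  rw [Finset.sum_comm]
  have hcard := Finset.sum_powerset_apply_card (x := (univ : Finset (Fin k)))
    (fun m => if 2 ≤ 2 * g₁ + m ∧ 2 ≤ 2 * (g - g₁) + (k - m) then
            corrSumOne τ N g₁ m * corrSumOne τ N (g - g₁ : ℕ) (k - m) else 0)
  rw [Finset.card_univ, Fintype.card_fin] at hcard
  simp only [nsmul_eq_mul] at hcard
  rw [← hcard]
  refine Finset.sum_congr rfl fun A _ => ?_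
  split_ifs
  · rw [sum_boxWt_mul_split A
      (fun p => ∑ b : Fin N, ttau τ g₁ (A.card + 1) (Fin.cons ((b : ℕ) : ℤ) (boxVal p)))
      (fun p => ∑ b : Fin N, ttau τ (g - g₁ : ℕ) (Aᶜ.card + 1)
        (Fin.cons ((b : ℕ) : ℤ) (boxVal p)))]
    have h5 : k - A.card = Aᶜ.card := by rw [Finset.card_compl, Fintype.card_fin]
    rw [h5]
    rfl
  · simp

/-- The rescaled correlators as a function of the list of their arguments. -/
noncomputable def corrList (τ : ℤ → (n : ℕ) → (Fin n → ℤ) → ℝ) (g : ℤ) (l : List ℤ) : ℝ :=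
  ttau τ g l.length l.get

theorem ttau_comp_cast (τ : ℤ → (n : ℕ) → (Fin n → ℤ) → ℝ) (g : ℤ) {n m : ℕ} (e : m = n)
    (a : Fin n → ℤ) : ttau τ g m (a ∘ Fin.cast e) = ttau τ g n a := by
  subst e
  rfl

theorem corrList_ofFn (τ : ℤ → (n : ℕ) → (Fin n → ℤ) → ℝ) (g : ℤ) {n : ℕ} (a : Fin n → ℤ) :
    corrList τ g (List.ofFn a) = ttau τ g n a := by
  rw [corrList, ← ttau_comp_cast τ g (List.length_ofFn (f := a)) a]
  congr 1
  funext i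
  simp only [List.get_ofFn]
  rfl

theorem List.Perm.exists_comp_eq_of_ofFn {n : ℕ} {a b : Fin n → ℤ}
    (hp : (List.ofFn a).Perm (List.ofFn b)) : a ∘ Tuple.sort a = b ∘ Tuple.sort b :=
  List.ofFn_injective
    ((((Tuple.sort a).ofFn_comp_perm a).trans (hp.trans ((Tuple.sort b).ofFn_comp_perm b).symm))
      |>.eq_of_pairwise' (Tuple.monotone_sort a).sortedLE_ofFn.pairwise
        (Tuple.monotone_sort b).sortedLE_ofFn.pairwise)

theorem DVVFamily.corrList_perm (h : DVVFamily τ) (g : ℤ) {l₁ l₂ : List ℤ} (hp : l₁.Perm l₂) :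
    corrList τ g l₁ = corrList τ g l₂ := by
  obtain ⟨n, hn⟩ : ∃ n, n = l₁.length := ⟨_, rfl⟩
  obtain ⟨a, rfl⟩ : ∃ a : Fin n → ℤ, List.ofFn a = l₁ := by
    subst hn
    exact ⟨_, List.ofFn_get l₁⟩
  obtain ⟨b, rfl⟩ : ∃ b : Fin n → ℤ, List.ofFn b = l₂ := by
    rw [hp.length_eq] at hn
    subst hn
    exact ⟨_, List.ofFn_get l₂⟩
  rw [corrList_ofFn, corrList_ofFn, ← h.ttau_comp g a (Tuple.sort a),
    ← h.ttau_comp g b (Tuple.sort b), hp.exists_comp_eq_of_ofFn]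

theorem DVVFamily.corrList_eq_zero_of_neg (h : DVVFamily τ) (g : ℤ) {l : List ℤ}
    (hl : ∃ y ∈ l, y < 0) : corrList τ g l = 0 := by
  obtain ⟨y, hy, hneg⟩ := hl
  obtain ⟨i, hi⟩ := List.mem_iff_get.1 hy
  exact h.ttau_eq_zero_of_neg g _ i (hi ▸ hneg)

theorem DVVFamily.corrList_eq_zero_of_sum_ne (h : DVVFamily τ) (g : ℤ) {l : List ℤ}
    (hl : l.sum ≠ 3 * g - 3 + l.length) : corrList τ g l = 0 := by
  refine h.ttau_eq_zero_of_sum_ne g _ ?_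
  rwa [← List.sum_ofFn, List.ofFn_get]

theorem DVVFamily.corrList_eq_zero_of_length (h : DVVFamily τ) {l : List ℤ}
    (hl : l.length ≤ 2) : corrList τ 0 l = 0 := by
  rw [corrList, ttau, h.vanish _ _ _ (fun hc => by have := hc.2.1; omega), mul_zero]

/-- The operator `Σ_i φ(t_i) f(t with t_i replaced by t_i + d)`. -/
def shiftSum (φ : ℤ → ℝ) (d : ℤ) : (List ℤ → ℝ) → List ℤ → ℝ
  | _, [] => 0
  | f, y :: t => φ y * f ((y + d) :: t) + shiftSum φ d (fun s => f (y :: s)) t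

/-- The sum of `f(A) g(B)` over all the splittings of a list into sublists `A`, `B`. -/
def splitSum : (List ℤ → ℝ) → (List ℤ → ℝ) → List ℤ → ℝ
  | f, g, [] => f [] * g []
  | f, g, y :: t => splitSum (fun s => f (y :: s)) g t + splitSum f (fun s => g (y :: s)) t

theorem shiftSum_ofFn (φ : ℤ → ℝ) (d : ℤ) {n : ℕ} (a : Fin n → ℤ) (f : List ℤ → ℝ) :
    shiftSum φ d f (List.ofFn a) =
      ∑ i, φ (a i) * f (List.ofFn (Function.update a i (a i + d))) := by
  induction n generalizing f with
  | zero => simp [shiftSum]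
  | succ n ih =>
    obtain ⟨x, p, rfl⟩ : ∃ x p, a = Fin.cons x p := ⟨a 0, Fin.tail a, (Fin.cons_self_tail a).symm⟩
    rw [List.ofFn_cons, shiftSum, ih, Fin.sum_univ_succ]
    simp [Fin.update_cons_zero, ← Fin.cons_update]

theorem splitSum_map {ι : Type*} [DecidableEq ι] (a : ι → ℤ) {L : List ι} (hL : L.Nodup)
    {f g : List ℤ → ℝ} (hf : ∀ l₁ l₂ : List ℤ, l₁.Perm l₂ → f l₁ = f l₂)
    (hg : ∀ l₁ l₂ : List ℤ, l₁.Perm l₂ → g l₁ = g l₂) :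
    splitSum f g (L.map a) = ∑ A ∈ L.toFinset.powerset,
      f (A.toList.map a) * g ((L.toFinset \ A).toList.map a) := by
  induction L generalizing f g with
  | nil => simp [splitSum]
  | cons x L ih =>
    obtain ⟨hx, hL⟩ := List.nodup_cons.1 hL
    have hx' : x ∉ L.toFinset := by simpa using hx
    rw [List.map_cons, splitSum, List.toFinset_cons, Finset.sum_powerset_insert hx',
      ih hL (fun _ _ hp => hf _ _ (hp.cons _)) hg, ih hL hf (fun _ _ hp => hg _ _ (hp.cons _)),
      add_comm]
    congr 1
    · refine Finset.sum_congr rfl fun A hA => ?_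
      rw [Finset.mem_powerset] at hA
      congr 1
      rw [Finset.insert_sdiff_of_notMem _ (fun hc => hx' (hA hc))]
      exact hg _ _ (((Finset.toList_insert (by simp [hx])).map a).symm)
    · refine Finset.sum_congr rfl fun A hA => ?_
      rw [Finset.mem_powerset] at hA
      congr 1
      · exact hf _ _ (((Finset.toList_insert (fun hc => hx' (hA hc))).map a).symm)
      · rw [Finset.insert_sdiff_insert, Finset.sdiff_insert_of_notMem hx']

theorem ofFn_orderIsoOfFin_perm {n : ℕ} (a : Fin n → ℤ) (A : Finset (Fin n)) :
    (List.ofFn fun j => a (A.orderIsoOfFin rfl j).1).Perm (A.toList.map a) := by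
  have : (List.ofFn fun j => a (A.orderIsoOfFin rfl j).1) =
      (List.ofFn fun j => (A.orderIsoOfFin rfl j).1).map a := by
    rw [List.map_ofFn]
    rfl
  rw [this]
  refine List.Perm.map a (List.perm_of_nodup_nodup_toFinset_eq ?_ A.nodup_toList ?_)
  · rw [List.nodup_ofFn]
    exact fun i j hij => (A.orderIsoOfFin rfl).injective (Subtype.ext hij)
  · ext x
    simp only [List.mem_toFinset, List.mem_ofFn', Set.mem_range, Finset.mem_toList]
    constructor
    · rintro ⟨j, rfl⟩
      exact (A.orderIsoOfFin rfl j).2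
    · intro hx
      exact ⟨(A.orderIsoOfFin rfl).symm ⟨x, hx⟩, by simp⟩

theorem splitSum_ofFn {n : ℕ} (a : Fin n → ℤ)
    {f g : List ℤ → ℝ} (hf : ∀ l₁ l₂ : List ℤ, l₁.Perm l₂ → f l₁ = f l₂)
    (hg : ∀ l₁ l₂ : List ℤ, l₁.Perm l₂ → g l₁ = g l₂) :
    splitSum f g (List.ofFn a) = ∑ A ∈ (univ : Finset (Fin n)).powerset,
      f (List.ofFn fun j => a (A.orderIsoOfFin rfl j).1) *
      g (List.ofFn fun j => a (Aᶜ.orderIsoOfFin rfl j).1) := by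
  rw [List.ofFn_eq_map, splitSum_map a (List.nodup_finRange n) hf hg, List.toFinset_finRange]
  refine Finset.sum_congr rfl fun A _ => ?_
  rw [← Finset.compl_eq_univ_sdiff, hf _ _ (ofFn_orderIsoOfFin_perm a A),
    hg _ _ (ofFn_orderIsoOfFin_perm a Aᶜ)]

theorem DVVFamily.corrList_dvv (h : DVVFamily τ) {a₀ : ℤ} (ha₀ : 0 ≤ a₀) {t : List ℤ}
    (ht : ∀ y ∈ t, 0 ≤ y) (hlen : 3 ≤ t.length) :
    corrList τ 0 (a₀ :: t) =
      shiftSum (fun y => 2 * (y : ℝ) + 1) (a₀ - 1) (corrList τ 0) t +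
      1 / 2 * ∑ b ∈ Finset.Icc (0 : ℤ) (a₀ - 2),
        (corrList τ (-1) (b :: (a₀ - 2 - b) :: t) +
          splitSum (fun s => corrList τ 0 (b :: s)) (fun s => corrList τ 0 ((a₀ - 2 - b) :: s)) t) := by
  obtain ⟨n, hn⟩ : ∃ n, n = t.length := ⟨_, rfl⟩
  obtain ⟨a, rfl⟩ : ∃ a : Fin n → ℤ, List.ofFn a = t := by
    subst hn
    exact ⟨_, List.ofFn_get t⟩
  rw [List.length_ofFn] at hlen
  rw [← List.ofFn_cons, corrList_ofFn, h.dvv 0 n le_rfl (by omega) a₀ a ha₀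
    (fun i => ht _ (List.mem_ofFn.2 ⟨i, rfl⟩)), shiftSum_ofFn]
  congr 1
  · refine Finset.sum_congr rfl fun i _ => ?_
    rw [corrList_ofFn, show a₀ + a i - 1 = a i + (a₀ - 1) by ring]
  · congr 1
    refine Finset.sum_congr rfl fun b _ => ?_
    rw [← List.ofFn_cons, ← List.ofFn_cons, corrList_ofFn, splitSum_ofFn a
      (fun _ _ hp => h.corrList_perm 0 (hp.cons _)) (fun _ _ hp => h.corrList_perm 0 (hp.cons _))]
    simp only [Finset.Icc_self, Finset.sum_singleton, zero_sub, mul_zero, zero_sub]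
    congr 1
    refine Finset.sum_congr rfl fun A _ => ?_
    simp only [← List.ofFn_cons, corrList_ofFn]
    split_ifs with hA
    · rfl
    · rw [← corrList_ofFn, ← corrList_ofFn τ 0 (Fin.cons (a₀ - 2 - b) _)]
      by_cases h1 : A.card ≤ 1
      · rw [h.corrList_eq_zero_of_length (l := List.ofFn _) (by simpa using h1), zero_mul]
      · rw [mul_comm, h.corrList_eq_zero_of_length (l := List.ofFn _) (by
          rw [List.length_ofFn]
          omega), zero_mul]

theorem shiftSum_congr (φ : ℤ → ℝ) (d : ℤ) {f g : List ℤ → ℝ} {t : List ℤ}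
    (hfg : ∀ s : List ℤ, s.length = t.length → f s = g s) :
    shiftSum φ d f t = shiftSum φ d g t := by
  induction t generalizing f g with
  | nil => rfl
  | cons y t ih =>
    rw [shiftSum, shiftSum, hfg _ (by simp), ih fun s hs => hfg _ (by simp [hs])]

theorem shiftSum_add (φ : ℤ → ℝ) (d : ℤ) (f g : List ℤ → ℝ) (t : List ℤ) :
    shiftSum φ d (fun s => f s + g s) t = shiftSum φ d f t + shiftSum φ d g t := by
  induction t generalizing f g with
  | nil => simp [shiftSum]
  | cons y t ih =>
    simp only [shiftSum, ih]
    ring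

theorem shiftSum_const_mul (φ : ℤ → ℝ) (d : ℤ) (c : ℝ) (f : List ℤ → ℝ) (t : List ℤ) :
    shiftSum φ d (fun s => c * f s) t = c * shiftSum φ d f t := by
  induction t generalizing f with
  | nil => simp [shiftSum]
  | cons y t ih =>
    simp only [shiftSum, ih]
    ring

theorem shiftSum_coeff_add (φ ψ : ℤ → ℝ) (c : ℝ) (d : ℤ) (f : List ℤ → ℝ) (t : List ℤ) :
    shiftSum (fun y => c * φ y + ψ y) d f t = c * shiftSum φ d f t + shiftSum ψ d f t := by
  induction t generalizing f with
  | nil => simp [shiftSum]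
  | cons y t ih =>
    simp only [shiftSum, ih]
    ring

theorem shiftSum_coeff_congr {φ ψ : ℤ → ℝ} (d : ℤ) (f : List ℤ → ℝ) {t : List ℤ}
    (hφ : ∀ y ∈ t, φ y = ψ y) : shiftSum φ d f t = shiftSum ψ d f t := by
  induction t generalizing f with
  | nil => rfl
  | cons y t ih =>
    simp only [List.mem_cons, forall_eq_or_imp] at hφ
    rw [shiftSum, shiftSum, hφ.1, ih _ hφ.2]

theorem shiftSum_zero (φ : ℤ → ℝ) (d : ℤ) (t : List ℤ) : shiftSum φ d (fun _ => 0) t = 0 := by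
  simpa using shiftSum_const_mul φ d 0 (fun _ => 0) t

theorem shiftSum_eq_zero_of_neg {φ : ℤ → ℝ} {d : ℤ} (hφ : ∀ y < 0, φ y = 0 ∨ y + d < 0)
    {f : List ℤ → ℝ} (hf : ∀ s : List ℤ, (∃ y ∈ s, y < 0) → f s = 0) {t : List ℤ}
    (ht : ∃ y ∈ t, y < 0) : shiftSum φ d f t = 0 := by
  induction t generalizing f with
  | nil => simp at ht
  | cons y t ih =>
    simp only [List.mem_cons, exists_eq_or_imp] at ht
    rw [shiftSum]
    rcases ht with hy | ht
    · have h0 : (fun s => f (y :: s)) = fun _ => 0 := funext fun s => hf _ ⟨y, by simp, hy⟩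
      rw [h0, shiftSum_zero, add_zero]
      rcases hφ y hy with h1 | h1
      · rw [h1, zero_mul]
      · rw [hf _ ⟨y + d, by simp, h1⟩, mul_zero]
    · rw [ih (fun s hs => hf _ (hs.imp fun z hz => ⟨List.mem_cons_of_mem _ hz.1, hz.2⟩)) ht,
        hf _ (ht.imp fun z hz => ⟨List.mem_cons_of_mem _ hz.1, hz.2⟩), mul_zero, add_zero]

theorem splitSum_add_left (f₁ f₂ g : List ℤ → ℝ) (t : List ℤ) :
    splitSum (fun s => f₁ s + f₂ s) g t = splitSum f₁ g t + splitSum f₂ g t := by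
  induction t generalizing f₁ f₂ g with
  | nil => simp [splitSum, add_mul]
  | cons y t ih =>
    simp only [splitSum, ih]
    ring

theorem splitSum_const_mul_left (c : ℝ) (f g : List ℤ → ℝ) (t : List ℤ) :
    splitSum (fun s => c * f s) g t = c * splitSum f g t := by
  induction t generalizing f g with
  | nil => simp [splitSum, mul_assoc]
  | cons y t ih =>
    simp only [splitSum, ih]
    ring

theorem splitSum_comm (f g : List ℤ → ℝ) (t : List ℤ) : splitSum f g t = splitSum g f t := by
  induction t generalizing f g with
  | nil => simp [splitSum, mul_comm]
  | cons y t ih => rw [splitSum, splitSum, ih, ih f, add_comm]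

theorem splitSum_zero_left (g : List ℤ → ℝ) (t : List ℤ) : splitSum (fun _ => 0) g t = 0 := by
  simpa using splitSum_const_mul_left 0 (fun _ => 0) g t

theorem splitSum_eq_zero_of_neg {f g : List ℤ → ℝ}
    (hf : ∀ s : List ℤ, (∃ y ∈ s, y < 0) → f s = 0)
    (hg : ∀ s : List ℤ, (∃ y ∈ s, y < 0) → g s = 0) {t : List ℤ}
    (ht : ∃ y ∈ t, y < 0) : splitSum f g t = 0 := by
  induction t generalizing f g with
  | nil => simp at ht
  | cons y t ih =>
    simp only [List.mem_cons, exists_eq_or_imp] at ht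
    rw [splitSum]
    rcases ht with hy | ht
    · have h0 : (fun s => f (y :: s)) = fun _ => 0 := funext fun s => hf _ ⟨y, by simp, hy⟩
      have h1 : (fun s => g (y :: s)) = fun _ => 0 := funext fun s => hg _ ⟨y, by simp, hy⟩
      rw [h0, h1, splitSum_comm f, splitSum_zero_left, splitSum_zero_left, add_zero]
    · rw [ih (fun s hs => hf _ (hs.imp fun z hz => ⟨List.mem_cons_of_mem _ hz.1, hz.2⟩)) hg ht,
        ih hf (fun s hs => hg _ (hs.imp fun z hz => ⟨List.mem_cons_of_mem _ hz.1, hz.2⟩)) ht,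
        add_zero]

/-- The commutator of two shift operators. -/
theorem shiftSum_shiftSum (φ ψ : ℤ → ℝ) (d e : ℤ) (f : List ℤ → ℝ) (t : List ℤ) :
    shiftSum φ d (shiftSum ψ e f) t = shiftSum ψ e (shiftSum φ d f) t +
      shiftSum (fun y => φ y * ψ (y + d) - ψ y * φ (y + e)) (d + e) f t := by
  induction t generalizing f with
  | nil => simp [shiftSum]
  | cons y t ih =>
    simp only [shiftSum, shiftSum_add, shiftSum_const_mul, ih,
      show y + d + e = y + (d + e) by ring, show y + e + d = y + (d + e) by ring]
    ring

/-- The Leibniz rule. -/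
theorem shiftSum_splitSum (φ : ℤ → ℝ) (d : ℤ) (f g : List ℤ → ℝ) (t : List ℤ) :
    shiftSum φ d (splitSum f g) t =
      splitSum (shiftSum φ d f) g t + splitSum f (shiftSum φ d g) t := by
  induction t generalizing f g with
  | nil => simp [shiftSum, splitSum]
  | cons y t ih =>
    have hr : ∀ f g₁ g₂ : List ℤ → ℝ, ∀ c : ℝ, splitSum f (fun s => c * g₁ s + g₂ s) t =
        c * splitSum f g₁ t + splitSum f g₂ t := fun f g₁ g₂ c => by
      rw [splitSum_comm, splitSum_add_left, splitSum_const_mul_left, splitSum_comm,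
        splitSum_comm g₂]
    simp only [shiftSum, splitSum, shiftSum_add, ih, hr, splitSum_add_left,
      splitSum_const_mul_left]
    ring

/-- Splitting off a single vanishing argument. -/
theorem splitSum_single_zero (c : ℝ) {f g : List ℤ → ℝ} (hfg : ∀ s, f s = g (0 :: s))
    (hg : ∀ l₁ l₂ : List ℤ, l₁.Perm l₂ → g l₁ = g l₂) (t : List ℤ) :
    splitSum (fun s => if s = [0] then c else 0) f t =
      c * shiftSum (fun y => if y = 0 then 1 else 0) 0 g t := by
  have hnil : ∀ (f : List ℤ → ℝ) (t : List ℤ),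
      splitSum (fun s => if s = [] then c else 0) f t = c * f t := by
    intro f t
    induction t generalizing f with
    | nil => simp [splitSum]
    | cons y t ih => simp [splitSum, splitSum_zero_left, ih]
  induction t generalizing f g with
  | nil => simp [splitSum, shiftSum]
  | cons y t ih =>
    rw [splitSum, shiftSum, ih (g := fun s => g (y :: s))
      (fun s => by rw [hfg]; exact hg _ _ (List.Perm.swap _ _ _))
      (fun _ _ hp => hg _ _ (hp.cons _))]
    by_cases hy : y = 0
    · subst hy
      simp only [List.cons.injEq, true_and, hnil, hfg, if_true, add_zero]
      ring
    · simp [hy, splitSum_zero_left]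

/-- The coefficient `2 y + 1` of the Virasoro operators. -/
def virCoeff (y : ℤ) : ℝ := 2 * (y : ℝ) + 1

/-- The coefficient `2 y + 1`, restricted to the nonnegative indices. -/
def virCoeffPos (y : ℤ) : ℝ := if 0 ≤ y then 2 * (y : ℝ) + 1 else 0

theorem shiftSum_virCoeffPos {t : List ℤ} (ht : ∀ y ∈ t, 0 ≤ y) (d : ℤ) (f : List ℤ → ℝ) :
    shiftSum virCoeffPos d f t = shiftSum virCoeff d f t :=
  shiftSum_coeff_congr d f fun y hy => if_pos (ht y hy)

theorem forall_nonneg_or_exists_neg (t : List ℤ) : (∀ y ∈ t, 0 ≤ y) ∨ ∃ y ∈ t, y < 0 := by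
  by_cases ht : ∀ y ∈ t, 0 ≤ y
  · exact Or.inl ht
  · push Not at ht
    exact Or.inr ht

theorem exists_neg_cons {t : List ℤ} (ht : ∃ y ∈ t, y < 0) (x : ℤ) : ∃ y ∈ x :: t, y < 0 :=
  ht.imp fun _ hz => ⟨List.mem_cons_of_mem _ hz.1, hz.2⟩

/-- The string equation. -/
theorem DVVFamily.corrList_zero_cons (h : DVVFamily τ) {t : List ℤ} (hlen : 3 ≤ t.length) :
    corrList τ 0 (0 :: t) = shiftSum virCoeff (-1) (corrList τ 0) t := by
  rcases forall_nonneg_or_exists_neg t with ht | ht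
  · rw [h.corrList_dvv le_rfl ht hlen]
    simp [show (fun y : ℤ => 2 * (y : ℝ) + 1) = virCoeff from rfl]
  · rw [h.corrList_eq_zero_of_neg 0 (exists_neg_cons ht 0),
      shiftSum_eq_zero_of_neg (fun y hy => Or.inr (by omega))
        (fun s hs => h.corrList_eq_zero_of_neg 0 hs) ht]

/-- The dilaton equation. -/
theorem DVVFamily.corrList_one_cons (h : DVVFamily τ) {t : List ℤ} (hlen : 3 ≤ t.length) :
    corrList τ 0 (1 :: t) = shiftSum virCoeff 0 (corrList τ 0) t := by
  rcases forall_nonneg_or_exists_neg t with ht | ht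
  · rw [h.corrList_dvv zero_le_one ht hlen]
    simp [show (fun y : ℤ => 2 * (y : ℝ) + 1) = virCoeff from rfl]
  · rw [h.corrList_eq_zero_of_neg 0 (exists_neg_cons ht 1),
      shiftSum_eq_zero_of_neg (fun y hy => Or.inr (by omega))
        (fun s hs => h.corrList_eq_zero_of_neg 0 hs) ht]

theorem DVVFamily.corrList_neg_one_eq (h : DVVFamily τ) {t : List ℤ} (hlen : 3 ≤ t.length) :
    corrList τ (-1) (0 :: 0 :: t) = 2 * corrList τ 0 (2 :: t) +
      (-2) * shiftSum virCoeffPos 1 (corrList τ 0) t +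
      (-1) * splitSum (fun s => corrList τ 0 (0 :: s)) (fun s => corrList τ 0 (0 :: s)) t := by
  rcases forall_nonneg_or_exists_neg t with ht | ht
  · have := h.corrList_dvv zero_le_two ht hlen
    rw [shiftSum_virCoeffPos ht]
    norm_num [show (fun y : ℤ => 2 * (y : ℝ) + 1) = virCoeff from rfl] at this
    linarith
  · rw [h.corrList_eq_zero_of_neg (-1) (exists_neg_cons (exists_neg_cons ht 0) 0),
      h.corrList_eq_zero_of_neg 0 (exists_neg_cons ht 2),
      shiftSum_eq_zero_of_neg (φ := virCoeffPos) (fun y hy => Or.inl (if_neg (by omega)))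
        (fun s hs => h.corrList_eq_zero_of_neg 0 hs) ht,
      splitSum_eq_zero_of_neg (fun s hs => h.corrList_eq_zero_of_neg 0 (exists_neg_cons hs 0))
        (fun s hs => h.corrList_eq_zero_of_neg 0 (exists_neg_cons hs 0)) ht]
    simp

theorem DVVFamily.corrList_zero_zero_cons (h : DVVFamily τ) (s : List ℤ) :
    corrList τ 0 (0 :: 0 :: s) = shiftSum virCoeff (-1) (fun s => corrList τ 0 (0 :: s)) s +
      if s = [0] then corrList τ 0 [0, 0, 0] else 0 := by
  match s with
  | [] => simp [shiftSum, h.corrList_eq_zero_of_length (l := [0, 0]) (by simp)]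
  | [x] =>
    by_cases hx : x = 0
    · subst hx
      simp [shiftSum, h.corrList_eq_zero_of_length (l := [0, -1]) (by simp)]
    · simp [shiftSum, h.corrList_eq_zero_of_length (l := [0, x + -1]) (by simp), hx,
        h.corrList_eq_zero_of_sum_ne 0 (l := [0, 0, x]) (by simp [hx])]
  | x :: y :: s =>
    rw [h.corrList_zero_cons (by simp), shiftSum,
      h.corrList_eq_zero_of_neg 0 (l := (0 + -1) :: x :: y :: s) ⟨0 + -1, by simp, by norm_num⟩]
    simp

theorem DVVFamily.corrList_neg_one_string (h : DVVFamily τ) {t : List ℤ} (hlen : 3 ≤ t.length) :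
    corrList τ (-1) (0 :: 0 :: 0 :: t) =
      shiftSum virCoeff (-1) (fun s => corrList τ (-1) (0 :: 0 :: s)) t +
      2 * (1 - corrList τ 0 [0, 0, 0]) *
        shiftSum (fun y => if y = 0 then 1 else 0) 0 (corrList τ 0) t := by
  have hperm : corrList τ 0 (2 :: 0 :: t) = corrList τ 0 (0 :: 2 :: t) :=
    h.corrList_perm 0 (List.Perm.swap _ _ _)
  have hsplit : splitSum (fun s => corrList τ 0 (0 :: 0 :: s)) (fun s => corrList τ 0 (0 :: s)) t =
      splitSum (shiftSum virCoeff (-1) fun s => corrList τ 0 (0 :: s))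
        (fun s => corrList τ 0 (0 :: s)) t +
      corrList τ 0 [0, 0, 0] *
        shiftSum (fun y => if y = 0 then 1 else 0) 0 (corrList τ 0) t := by
    rw [funext h.corrList_zero_zero_cons, splitSum_add_left,
      splitSum_single_zero _ (fun _ => rfl) (fun _ _ hp => h.corrList_perm 0 hp)]
  have hL : shiftSum virCoeffPos 1 (fun s => corrList τ 0 (0 :: s)) t =
      shiftSum virCoeffPos 1 (shiftSum virCoeff (-1) (corrList τ 0)) t :=
    shiftSum_congr _ _ fun s hs => h.corrList_zero_cons (by omega)
  have hcomm := shiftSum_shiftSum virCoeff virCoeffPos (-1) 1 (corrList τ 0) t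
  have hcoeff : shiftSum (fun y => virCoeff y * virCoeffPos (y + -1) -
      virCoeffPos y * virCoeff (y + 1)) (-1 + 1) (corrList τ 0) t =
      -4 * corrList τ 0 (1 :: t) +
        shiftSum (fun y => if y = 0 then 1 else 0) 0 (corrList τ 0) t := by
    rw [h.corrList_one_cons hlen, ← shiftSum_coeff_add]
    rcases forall_nonneg_or_exists_neg t with ht | ht
    · refine shiftSum_coeff_congr _ _ fun y hy => ?_
      have hy0 := ht y hy
      rcases hy0.eq_or_lt with rfl | hy1
      · norm_num [virCoeff, virCoeffPos]
      · rw [virCoeffPos, virCoeffPos, if_pos (by omega), if_pos hy0, if_neg (by omega),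
          virCoeff, virCoeff]
        push_cast
        ring
    · rw [shiftSum_eq_zero_of_neg (fun y hy => Or.inr (by omega))
        (fun s hs => h.corrList_eq_zero_of_neg 0 hs) ht, shiftSum_eq_zero_of_neg
        (fun y hy => Or.inr (by omega)) (fun s hs => h.corrList_eq_zero_of_neg 0 hs) ht]
  have hW : shiftSum virCoeff (-1) (fun s => corrList τ (-1) (0 :: 0 :: s)) t =
      2 * shiftSum virCoeff (-1) (fun s => corrList τ 0 (2 :: s)) t +
      (-2) * shiftSum virCoeff (-1) (shiftSum virCoeffPos 1 (corrList τ 0)) t +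
      (-1) * shiftSum virCoeff (-1) (splitSum (fun s => corrList τ 0 (0 :: s))
        (fun s => corrList τ 0 (0 :: s))) t := by
    rw [shiftSum_congr _ _ fun s hs => h.corrList_neg_one_eq (t := s) (by omega)]
    rw [shiftSum_add, shiftSum_add, shiftSum_const_mul, shiftSum_const_mul, shiftSum_const_mul]
  rw [hcoeff] at hcomm
  rw [h.corrList_neg_one_eq (by simp; omega), hperm, h.corrList_zero_cons (by simp; omega),
    shiftSum, shiftSum, splitSum, splitSum_comm (fun s => corrList τ 0 (0 :: s)), hL, hW, hcomm,
    shiftSum_splitSum, splitSum_comm (fun s => corrList τ 0 (0 :: s)) (shiftSum _ _ _), hsplit]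
  norm_num [virCoeff, virCoeffPos]
  ring

theorem zero_mem_of_sum_lt {t : List ℤ} (h0 : ∀ y ∈ t, 0 ≤ y) (ht : t.sum < t.length) :
    (0 : ℤ) ∈ t := by
  by_contra hc
  have : t.length • (1 : ℤ) ≤ t.sum := List.card_nsmul_le_sum t 1 fun x hx => by
    have h1 := h0 x hx
    have h2 : x ≠ 0 := fun h3 => hc (h3 ▸ hx)
    omega
  simp only [nsmul_eq_mul, mul_one] at this
  omega

/-- A symmetric function subject to the string equation and to a dimension constraint
vanishes as soon as its initial value does. -/
theorem eq_zero_of_string {V : List ℤ → ℝ} {q : ℕ} (hq : 1 ≤ q)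
    (hperm : ∀ l₁ l₂ : List ℤ, l₁.Perm l₂ → V l₁ = V l₂)
    (hneg : ∀ s : List ℤ, (∃ y ∈ s, y < 0) → V s = 0)
    (hsum : ∀ s : List ℤ, s.sum ≠ s.length - q → V s = 0)
    (hstring : ∀ s : List ℤ, q ≤ s.length → V (0 :: s) = shiftSum virCoeff (-1) V s)
    (hbase : V (List.replicate q 0) = 0) {t : List ℤ} (ht : q ≤ t.length) : V t = 0 := by
  obtain ⟨m, hm⟩ := Nat.exists_eq_add_of_le ht
  induction m generalizing t with
  | zero =>
    rcases forall_nonneg_or_exists_neg t with h0 | h0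
    · by_cases hs : t.sum = t.length - q
      · have : t = List.replicate q 0 := by
          refine List.eq_replicate_iff.2 ⟨hm, fun b hb => ?_⟩
          have h1 := List.single_le_sum h0 b hb
          have h2 := h0 b hb
          omega
        rw [this, hbase]
      · exact hsum t hs
    · exact hneg t h0
  | succ m ih =>
    rcases forall_nonneg_or_exists_neg t with h0 | h0
    · by_cases hs : t.sum = t.length - q
      · have hmem : (0 : ℤ) ∈ t := zero_mem_of_sum_lt h0 (by omega)
        have hlen := List.length_erase_of_mem hmem
        rw [hperm _ _ (List.perm_cons_erase hmem), hstring _ (by omega),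
          shiftSum_congr (g := fun _ => 0) _ _ fun s hs => ih (by omega) (by omega), shiftSum_zero]
      · exact hsum t hs
    · exact hneg t h0

theorem DVVFamily.corrList_three (h : DVVFamily τ) :
    corrList τ 0 [0, 0, 0] * (1 - corrList τ 0 [0, 0, 0]) = 0 := by
  have s1 : corrList τ 0 [0, 0, 0, 1] = 3 * corrList τ 0 [0, 0, 0] := by
    rw [h.corrList_zero_cons (by simp)]
    norm_num [shiftSum, virCoeff, h.corrList_eq_zero_of_neg]
  have s2 : corrList τ 0 [0, 0, 0, 0, 2] = 5 * corrList τ 0 [0, 0, 0, 1] := by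
    rw [h.corrList_zero_cons (by simp)]
    norm_num [shiftSum, virCoeff, h.corrList_eq_zero_of_neg]
  have s3 : corrList τ 0 [0, 0, 0, 0, 0, 3] = 7 * corrList τ 0 [0, 0, 0, 0, 2] := by
    rw [h.corrList_zero_cons (by simp)]
    norm_num [shiftSum, virCoeff, h.corrList_eq_zero_of_neg]
  have u0 : corrList τ (-1) [0, 0, 0, 0, 0, 0] =
      6 * (1 - corrList τ 0 [0, 0, 0]) * corrList τ 0 [0, 0, 0] := by
    rw [h.corrList_neg_one_string (by simp)]
    norm_num [shiftSum, virCoeff, h.corrList_eq_zero_of_neg]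
    ring
  have u1 : corrList τ (-1) [0, 0, 0, 0, 0, 0, 1] =
      3 * corrList τ (-1) [0, 0, 0, 0, 0, 0] +
      6 * (1 - corrList τ 0 [0, 0, 0]) * corrList τ 0 [0, 0, 0, 1] := by
    rw [h.corrList_neg_one_string (by simp)]
    norm_num [shiftSum, virCoeff, h.corrList_eq_zero_of_neg]
    ring
  have p0 : ∀ l : List ℤ, l.Perm [0, 0, 0, 1] → corrList τ 0 l = corrList τ 0 [0, 0, 0, 1] :=
    fun l hl => h.corrList_perm 0 hl
  have p1 : ∀ l : List ℤ, l.Perm [0, 0, 0, 0, 2] → corrList τ 0 l = corrList τ 0 [0, 0, 0, 0, 2] :=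
    fun l hl => h.corrList_perm 0 hl
  have p2 : ∀ l : List ℤ, l.Perm [0, 0, 0, 0, 0, 0, 1] →
      corrList τ (-1) l = corrList τ (-1) [0, 0, 0, 0, 0, 0, 1] :=
    fun l hl => h.corrList_perm (-1) hl
  have z : ∀ l : List ℤ, l.sum ≠ l.length - 3 → corrList τ 0 l = 0 :=
    fun l hl => h.corrList_eq_zero_of_sum_ne 0 (by omega)
  have key := h.corrList_dvv (a₀ := 3) (t := [0, 0, 0, 0, 0]) (by norm_num) (by simp) (by simp)
  rw [h.corrList_perm 0 (l₂ := [0, 0, 0, 0, 0, 3]) (by decide), s3, s2, s1,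
    show Finset.Icc (0 : ℤ) (3 - 2) = {0, 1} by decide, Finset.sum_pair zero_ne_one] at key
  simp only [shiftSum, splitSum] at key
  norm_num at key
  rw [p2 [1, 0, 0, 0, 0, 0, 0] (by decide), p2 [0, 1, 0, 0, 0, 0, 0] (by decide), u1, u0,
    p0 [1, 0, 0, 0] (by decide), s1] at key
  rw [p1 [2, 0, 0, 0, 0] (by decide), p1 [0, 2, 0, 0, 0] (by decide), p1 [0, 0, 2, 0, 0] (by decide),
    p1 [0, 0, 0, 2, 0] (by decide), s2, s1] at key
  rw [z [1] (by simp), z [1, 0] (by simp), z [1, 0, 0] (by simp), z [1, 0, 0, 0, 0] (by simp),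
    z [1, 0, 0, 0, 0, 0] (by simp)] at key
  linarith

theorem DVVFamily.corrList_neg_one (h : DVVFamily τ) (l : List ℤ) : corrList τ (-1) l = 0 := by
  have hc := h.corrList_three
  have hV : ∀ t : List ℤ, 3 ≤ t.length →
      (1 - corrList τ 0 [0, 0, 0]) * corrList τ 0 t = 0 := fun t ht =>
    eq_zero_of_string (V := fun t => (1 - corrList τ 0 [0, 0, 0]) * corrList τ 0 t) (q := 3)
      (by norm_num) (fun _ _ hp => by rw [h.corrList_perm 0 hp])
      (fun s hs => by rw [h.corrList_eq_zero_of_neg 0 hs, mul_zero])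
      (fun s hs => by
        rw [h.corrList_eq_zero_of_sum_ne 0 (l := s) (by push_cast at hs; omega), mul_zero])
      (fun s hs => by rw [shiftSum_const_mul, h.corrList_zero_cons hs])
      (by rw [mul_comm]; exact hc) ht
  have hW : ∀ t : List ℤ, 4 ≤ t.length → corrList τ (-1) (0 :: 0 :: t) = 0 := fun t ht => by
    refine eq_zero_of_string (V := fun t => corrList τ (-1) (0 :: 0 :: t)) (q := 4)
      (by norm_num) (fun _ _ hp => h.corrList_perm _ ((hp.cons _).cons _))
      (fun s hs => h.corrList_eq_zero_of_neg _ (exists_neg_cons (exists_neg_cons hs 0) 0))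
      (fun s hs => h.corrList_eq_zero_of_sum_ne _ (by
        simp only [List.sum_cons, List.length_cons]
        push_cast at hs ⊢
        omega))
      (fun s hs => ?_) ?_ ht
    · rw [h.corrList_neg_one_string (by omega), mul_assoc, ← shiftSum_const_mul,
        shiftSum_congr (g := fun _ => 0) _ 0 fun s₁ hs₁ => hV s₁ (by omega), shiftSum_zero,
        mul_zero, add_zero]
    · have : corrList τ (-1) (0 :: 0 :: 0 :: [0, 0, 0]) = 0 := by
        rw [h.corrList_neg_one_string (by simp)]
        norm_num [shiftSum, virCoeff, h.corrList_eq_zero_of_neg]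
        grind
      exact this
  rcases forall_nonneg_or_exists_neg l with h0 | h0
  · by_cases hs : l.sum = l.length - 6
    · have hpos := List.sum_nonneg h0
      have m1 := zero_mem_of_sum_lt h0 (by omega)
      have e1 := List.perm_cons_erase m1
      have l1 := e1.length_eq
      have t1 := e1.sum_eq
      rw [List.length_cons] at l1
      rw [List.sum_cons] at t1
      have m2 := zero_mem_of_sum_lt (fun y hy => h0 y (List.mem_of_mem_erase hy))
        (show (l.erase 0).sum < (l.erase 0).length by omega)
      have e2 := List.perm_cons_erase m2
      have l2 := e2.length_eq
      rw [List.length_cons] at l2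
      rw [h.corrList_perm _ (e1.trans (e2.cons _)), hW _ (by omega)]
    · exact h.corrList_eq_zero_of_sum_ne _ (by omega)
  · exact h.corrList_eq_zero_of_neg _ h0

theorem DVVFamily.ttau_neg_one (h : DVVFamily τ) {n : ℕ}
    (a : Fin n → ℤ) : ttau τ (-1) n a = 0 := by
  rw [← corrList_ofFn, h.corrList_neg_one]

/-- The pairs `(g, k)` with `2 g + k = n`. -/
def genusPairs (n : ℕ) : Finset (ℕ × ℕ) :=
  (Finset.range (n + 1) ×ˢ Finset.range (n + 1)).filter fun x => 2 * x.1 + x.2 = n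

theorem mem_genusPairs {n : ℕ} {x : ℕ × ℕ} : x ∈ genusPairs n ↔ 2 * x.1 + x.2 = n := by
  simp only [genusPairs, Finset.mem_filter, Finset.mem_product, Finset.mem_range]
  omega

theorem sum_genusPairs_eq_range (n : ℕ) (f : ℕ → ℕ → ℝ) :
    ∑ x ∈ genusPairs n, f x.1 x.2 =
      ∑ g ∈ Finset.range (n + 1), if 2 * g ≤ n then f g (n - 2 * g) else 0 := by
  rw [← Finset.sum_filter]
  refine Finset.sum_nbij' (fun x => x.1) (fun g => (g, n - 2 * g)) ?_ ?_ ?_ ?_ ?_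
  · intro x hx
    rw [mem_genusPairs] at hx
    simp only [Finset.mem_filter, Finset.mem_range]
    omega
  · intro g hg
    simp only [Finset.mem_filter, Finset.mem_range] at hg
    rw [mem_genusPairs]
    omega
  · intro x hx
    rw [mem_genusPairs] at hx
    ext
    · rfl
    · simp only
      omega
  · simp
  · intro x hx
    rw [mem_genusPairs] at hx
    congr 1
    omega

theorem sum_genusPairs_pred_snd (n : ℕ) (f : ℕ → ℕ → ℝ) :
    ∑ x ∈ genusPairs (n + 1), (if x.2 = 0 then 0 else f x.1 (x.2 - 1)) =
      ∑ x ∈ genusPairs n, f x.1 x.2 := by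
  have : ∀ x : ℕ × ℕ, (if x.2 = 0 then 0 else f x.1 (x.2 - 1)) =
    if x.2 ≠ 0 then f x.1 (x.2 - 1) else 0 := fun x => by simp
  rw [Finset.sum_congr rfl fun x _ => this x, ← Finset.sum_filter]
  refine Finset.sum_nbij' (fun x => (x.1, x.2 - 1)) (fun x => (x.1, x.2 + 1)) ?_ ?_ ?_ ?_ ?_
  · intro x hx
    rw [Finset.mem_filter, mem_genusPairs] at hx
    rw [mem_genusPairs]
    omega
  · intro x hx
    rw [mem_genusPairs] at hx
    rw [Finset.mem_filter, mem_genusPairs]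
    omega
  · intro x hx
    rw [Finset.mem_filter, mem_genusPairs] at hx
    ext
    · rfl
    · simp only
      omega
  · simp
  · simp

theorem sum_genusPairs_pred_fst (n : ℕ) (f : ℕ → ℕ → ℝ) :
    ∑ x ∈ genusPairs (n + 2), (if x.1 = 0 then 0 else f (x.1 - 1) x.2) =
      ∑ x ∈ genusPairs n, f x.1 x.2 := by
  have : ∀ x : ℕ × ℕ, (if x.1 = 0 then 0 else f (x.1 - 1) x.2) =
    if x.1 ≠ 0 then f (x.1 - 1) x.2 else 0 := fun x => by simp
  rw [Finset.sum_congr rfl fun x _ => this x, ← Finset.sum_filter]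
  refine Finset.sum_nbij' (fun x => (x.1 - 1, x.2)) (fun x => (x.1 + 1, x.2)) ?_ ?_ ?_ ?_ ?_
  · intro x hx
    rw [Finset.mem_filter, mem_genusPairs] at hx
    rw [mem_genusPairs]
    omega
  · intro x hx
    rw [mem_genusPairs] at hx
    rw [Finset.mem_filter, mem_genusPairs]
    omega
  · intro x hx
    rw [Finset.mem_filter, mem_genusPairs] at hx
    ext
    · simp only
      omega
    · rfl
  · simp
  · simp

theorem sum_genusPairs_conv (n : ℕ) (F : ℕ × ℕ → ℕ × ℕ → ℝ) :
    ∑ x ∈ genusPairs n, ∑ g ∈ Finset.range (x.1 + 1), ∑ m ∈ Finset.range (x.2 + 1),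
      F (g, m) (x.1 - g, x.2 - m) =
    ∑ i ∈ Finset.range (n + 1), ∑ y ∈ genusPairs i, ∑ z ∈ genusPairs (n - i), F y z := by
  simp only [← Finset.sum_product', Finset.sum_sigma']
  refine Finset.sum_nbij'
    (fun s => ⟨2 * s.2.1 + s.2.2, ((s.2.1, s.2.2), (s.1.1 - s.2.1, s.1.2 - s.2.2))⟩)
    (fun s => ⟨(s.2.1.1 + s.2.2.1, s.2.1.2 + s.2.2.2), (s.2.1.1, s.2.1.2)⟩) ?_ ?_ ?_ ?_ ?_
  · rintro ⟨⟨g, k⟩, ⟨g₁, m⟩⟩ hs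
    simp only [Finset.mem_sigma, Finset.mem_product, Finset.mem_range, mem_genusPairs] at hs ⊢
    exact ⟨by omega, trivial, by omega⟩
  · rintro ⟨i, ⟨⟨g, k⟩, ⟨g₁, m⟩⟩⟩ hs
    simp only [Finset.mem_sigma, Finset.mem_product, Finset.mem_range, mem_genusPairs] at hs ⊢
    omega
  · rintro ⟨⟨g, k⟩, ⟨g₁, m⟩⟩ hs
    simp only [Finset.mem_sigma, Finset.mem_product, Finset.mem_range, mem_genusPairs] at hs
    have h1 : g₁ + (g - g₁) = g := by omega
    have h2 : m + (k - m) = k := by omega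
    simp only [h1, h2]
  · rintro ⟨i, ⟨⟨g, k⟩, ⟨g₁, m⟩⟩⟩ hs
    simp only [Finset.mem_sigma, Finset.mem_product, Finset.mem_range, mem_genusPairs] at hs
    obtain ⟨_, rfl, _⟩ := hs
    simp
  · simp

/-- The coefficient of `-(2u)^(-(3n-1)/2)` in the derivative of `Sfun τ n`. -/
noncomputable def wkbCoeff (τ : ℤ → (n : ℕ) → (Fin n → ℤ) → ℝ) (N n : ℕ) : ℝ :=
  ∑ x ∈ genusPairs n, corrSumOne τ N x.1 x.2 / (x.2.factorial : ℝ)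

theorem DVVFamily.wkbCoeff_eq (h : DVVFamily τ) (N n : ℕ) :
    wkbCoeff τ N n = 3 * (n - 1) *
      ∑ x ∈ genusPairs n, corrSum τ N x.1 (x.2 + 1) / ((x.2 + 1).factorial : ℝ) := by
  rw [wkbCoeff, Finset.mul_sum]
  refine Finset.sum_congr rfl fun x hx => ?_
  rw [mem_genusPairs] at hx
  have h1 := h.corrSum_succ N x.1 x.2
  have h2 : (n : ℝ) = 2 * x.1 + x.2 := by exact_mod_cast hx.symm
  have h3 : (x.2.factorial : ℝ) ≠ 0 := by positivity
  have h4 : (x.2 : ℝ) + 1 ≠ 0 := by positivity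
  rw [Nat.factorial_succ, h2]
  push_cast at h1 ⊢
  field_simp
  linear_combination h1

theorem DVVFamily.sum_corrSumTwice_add (h : DVVFamily τ) (N n : ℕ) :
    ∑ x ∈ genusPairs (n + 1), corrSumTwice τ N x.1 x.2 / (x.2.factorial : ℝ) +
      ∑ x ∈ genusPairs n, corrSumPair τ N x.1 x.2 / (x.2.factorial : ℝ) =
      3 * n * wkbCoeff τ N (n + 1) := by
  rw [← sum_genusPairs_pred_snd n fun g k => corrSumPair τ N g k / (k.factorial : ℝ),
    ← Finset.sum_add_distrib, wkbCoeff, Finset.mul_sum]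
  refine Finset.sum_congr rfl fun x hx => ?_
  rw [mem_genusPairs] at hx
  obtain ⟨g, _ | k⟩ := x
  · have h1 := h.corrSumOne_zero N g
    have h2 : (n : ℝ) + 1 = 2 * g := by exact_mod_cast hx.symm
    simp only [Nat.factorial_zero, Nat.cast_one, div_one, if_true, add_zero]
    push_cast at h1
    rw [h1]
    linear_combination -3 * corrSumOne τ N g 0 * h2
  · have h1 := h.corrSumOne_succ N g k
    have h2 : (n : ℝ) + 1 = 2 * g + (k + 1) := by exact_mod_cast hx.symm
    have h3 : (k.factorial : ℝ) ≠ 0 := by positivity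
    have h4 : (k : ℝ) + 1 ≠ 0 := by positivity
    simp only [Nat.factorial_succ, Nat.add_sub_cancel, Nat.succ_ne_zero, if_false]
    push_cast at h1 ⊢
    field_simp
    linear_combination h1 - 3 * corrSumOne τ N g (k + 1) * h2

theorem DVVFamily.corrSumPair_neg_one (h : DVVFamily τ) (N k : ℕ) :
    corrSumPair τ N (-1) k = 0 := by
  refine Finset.sum_eq_zero fun a _ => mul_eq_zero_of_right _ <|
    Finset.sum_eq_zero fun b _ => Finset.sum_eq_zero fun c _ => ?_
  rw [h.ttau_neg_one]

theorem DVVFamily.wkbCoeff_rec (h : DVVFamily τ) (N n : ℕ) (hn : 3 ≤ n) (hN : 2 * n ≤ N) :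
    2 * wkbCoeff τ N n = 3 * (n - 1) * wkbCoeff τ N (n - 1) +
      ∑ i ∈ Finset.range (n + 1), if 2 ≤ i ∧ 2 ≤ n - i then
        wkbCoeff τ N i * wkbCoeff τ N (n - i) else 0 := by
  obtain ⟨n, rfl⟩ : ∃ m, n = m + 2 := ⟨n - 2, by omega⟩
  have hconv := sum_genusPairs_conv (n + 2) fun y z =>
    if 2 ≤ 2 * y.1 + y.2 ∧ 2 ≤ 2 * z.1 + z.2 then
      (corrSumOne τ N y.1 y.2 / (y.2.factorial : ℝ)) *
        (corrSumOne τ N z.1 z.2 / (z.2.factorial : ℝ)) else 0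
  have hprod : ∀ i, (∑ y ∈ genusPairs i, ∑ z ∈ genusPairs (n + 2 - i),
      if 2 ≤ 2 * y.1 + y.2 ∧ 2 ≤ 2 * z.1 + z.2 then
      (corrSumOne τ N y.1 y.2 / (y.2.factorial : ℝ)) *
        (corrSumOne τ N z.1 z.2 / (z.2.factorial : ℝ)) else 0) =
      if 2 ≤ i ∧ 2 ≤ n + 2 - i then wkbCoeff τ N i * wkbCoeff τ N (n + 2 - i) else 0 := by
    intro i
    rw [wkbCoeff, wkbCoeff, Finset.sum_mul_sum]
    split_ifs with hi
    · refine Finset.sum_congr rfl fun y hy => Finset.sum_congr rfl fun z hz => ?_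
      rw [mem_genusPairs] at hy hz
      rw [hy, hz, if_pos hi]
    · refine Finset.sum_eq_zero fun y hy => Finset.sum_eq_zero fun z hz => ?_
      rw [mem_genusPairs] at hy hz
      rw [hy, hz, if_neg hi]
  rw [Finset.sum_congr rfl fun i _ => hprod i] at hconv
  rw [← hconv]
  have h1 := h.sum_corrSumTwice_add N n
  rw [← sum_genusPairs_pred_snd (n + 1) fun g k => corrSumTwice τ N g k / (k.factorial : ℝ),
    ← sum_genusPairs_pred_fst n fun g k => corrSumPair τ N g k / (k.factorial : ℝ)] at h1
  have h2 : ∑ x ∈ genusPairs (n + 1 + 1), (if x.2 = 0 then 0 else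
      corrSumOne τ N x.1 (x.2 - 1 : ℕ) / ((x.2 - 1).factorial : ℝ)) = wkbCoeff τ N (n + 1) :=
    sum_genusPairs_pred_snd (n + 1) fun g k => corrSumOne τ N g k / (k.factorial : ℝ)
  have h3 : n + 2 - 1 = n + 1 := rfl
  have h4 : 3 * (((n + 2 : ℕ) : ℝ) - 1) * wkbCoeff τ N (n + 1) =
      3 * n * wkbCoeff τ N (n + 1) + 3 * wkbCoeff τ N (n + 1) := by
    push_cast
    ring
  rw [h3, h4, ← h1]
  rw [← h2, wkbCoeff, Finset.mul_sum, Finset.mul_sum, ← Finset.sum_add_distrib,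
    ← Finset.sum_add_distrib, ← Finset.sum_add_distrib]
  refine Finset.sum_congr rfl fun x hx => ?_
  rw [mem_genusPairs] at hx
  obtain ⟨g, k⟩ := x
  simp only at hx ⊢
  rw [h.corrSumOne_rec N g k (by omega) (by omega)]
  have hpair : corrSumPair τ N (g - 1) k / (k.factorial : ℝ) =
      if g = 0 then 0 else corrSumPair τ N (g - 1 : ℕ) k / (k.factorial : ℝ) := by
    obtain _ | g := g
    · simp [h.corrSumPair_neg_one]
    · simp
  have hlast : (∑ g₁ ∈ Finset.range (g + 1), ∑ m ∈ Finset.range (k + 1), (k.choose m : ℝ) *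
          if 2 ≤ 2 * g₁ + m ∧ 2 ≤ 2 * (g - g₁) + (k - m) then
            corrSumOne τ N g₁ m * corrSumOne τ N (g - g₁ : ℕ) (k - m) else 0) /
        (k.factorial : ℝ) =
      ∑ g₁ ∈ Finset.range (g + 1), ∑ m ∈ Finset.range (k + 1),
        if 2 ≤ 2 * g₁ + m ∧ 2 ≤ 2 * (g - g₁) + (k - m) then
          (corrSumOne τ N g₁ m / (m.factorial : ℝ)) *
          (corrSumOne τ N (g - g₁ : ℕ) (k - m) / ((k - m).factorial : ℝ)) else 0 := by
    rw [Finset.sum_div]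
    refine Finset.sum_congr rfl fun g₁ _ => ?_
    rw [Finset.sum_div]
    refine Finset.sum_congr rfl fun m hm => ?_
    rw [Finset.mem_range] at hm
    rw [Nat.cast_choose ℝ (by omega : m ≤ k)]
    have h3 : (k.factorial : ℝ) ≠ 0 := by positivity
    split_ifs
    · field_simp
    · simp
  have hfirst : (k : ℝ) * (1 / 2 * corrSumTwice τ N g (k - 1) +
        3 / 2 * corrSumOne τ N g (k - 1)) / (k.factorial : ℝ) =
      1 / 2 * (if k = 0 then 0 else corrSumTwice τ N g (k - 1) / ((k - 1).factorial : ℝ)) +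
      3 / 2 * (if k = 0 then 0 else corrSumOne τ N g (k - 1) / ((k - 1).factorial : ℝ)) := by
    obtain _ | k := k
    · simp
    · have h3 : (k.factorial : ℝ) ≠ 0 := by positivity
      have h4 : (k : ℝ) + 1 ≠ 0 := by positivity
      simp only [Nat.factorial_succ, Nat.add_sub_cancel, Nat.succ_ne_zero, if_false]
      push_cast
      field_simp
  rw [← hlast, ← hpair, add_div, hfirst]
  ring

theorem dfac_two_mul_sub_one (a : ℕ) :
    dfac (2 * (a : ℤ) - 1) = (2 * (a : ℝ) + 1)⁻¹ * dfac (2 * (a : ℤ) + 1) := by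
  obtain _ | a := a
  · simp [dfac]
  · have e1 : (2 * ((a + 1 : ℕ) : ℤ) - 1).toNat = 2 * a + 1 := by omega
    have e2 : (2 * ((a + 1 : ℕ) : ℤ) + 1).toNat = 2 * a + 1 + 2 := by omega
    rw [dfac, dfac, e1, e2, Nat.doubleFactorial_add_two]
    have := two_mul_add_one_ne_zero (a + 1)
    push_cast at this ⊢
    field_simp
    ring

theorem DVVFamily.corrSum_eq_of_le (h : DVVFamily τ) {M N : ℕ} (hMN : M ≤ N) {g : ℤ} {k : ℕ}
    (hM : 3 * g - 3 + k < M) : corrSum τ M g k = corrSum τ N g k := by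
  refine Finset.sum_of_injOn (fun a i => Fin.castLE hMN (a i)) ?_ (by simp) ?_ ?_
  · intro a _ b _ hab
    funext i
    exact Fin.castLE_injective hMN (congrFun hab i)
  · intro b _ hb
    have : ∃ i, M ≤ (b i : ℕ) := by
      by_contra! hc
      exact hb ⟨fun i => ⟨b i, hc i⟩, by simp, by funext i; rfl⟩
    obtain ⟨i, hi⟩ := this
    rw [h.ttau_eq_zero_of_sum_ne, mul_zero]
    have := Finset.single_le_sum (fun j _ => boxVal_nonneg b j) (Finset.mem_univ i)
    have h1 : boxVal b i = ((b i : ℕ) : ℤ) := rfl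
    omega
  · intro a _
    rfl

theorem DVVFamily.OmegaF_eq (h : DVVFamily τ) {N : ℕ} {g : ℤ} {k : ℕ}
    (hN : (3 * g + k - 3).toNat + 1 ≤ N) {w : ℝ} (hw : 0 < w) :
    OmegaF τ g k (fun _ => w) = corrSum τ N g k * w ^ (3 * (g : ℝ) - 3 + 3 * k / 2) := by
  rw [← h.corrSum_eq_of_le hN (by push_cast; omega), OmegaF, corrSum, Finset.sum_mul]
  refine Finset.sum_congr rfl fun a _ => ?_
  change τ g k (boxVal a) * _ = _
  by_cases ha : ∑ i, boxVal a i = 3 * g - 3 + k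
  · have hexp : (∏ i, w ^ (((a i : ℕ) : ℝ) + 1 / 2)) = w ^ (3 * (g : ℝ) - 3 + 3 * k / 2) := by
      rw [← Real.rpow_sum_of_pos hw, Finset.sum_add_distrib]
      congr 1
      have : ∑ i, ((a i : ℕ) : ℝ) = 3 * g - 3 + k := by
        have := congrArg (Int.cast : ℤ → ℝ) ha
        simpa [boxVal] using this
      rw [this]
      simp
      ring
    rw [Finset.prod_mul_distrib, hexp, boxWt, ttau]
    simp only [dfac_two_mul_sub_one, Finset.prod_mul_distrib, boxVal]
    ring
  · rw [h.ttau_eq_zero_of_sum_ne g _ ha, h.vanish g k _ fun hc => ha hc.2.2]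
    simp

theorem DVVFamily.Sfun_eq (h : DVVFamily τ) {N n : ℕ} (hN : 2 * n + 1 ≤ N) {u : ℝ} (hu : 0 < u) :
    Sfun τ n u = (∑ x ∈ genusPairs n, corrSum τ N x.1 (x.2 + 1) / ((x.2 + 1).factorial : ℝ)) *
      (2 * u) ^ (-(3 * ((n : ℝ) - 1) / 2)) := by
  rw [Sfun, ← sum_genusPairs_eq_range n fun g k => (1 / ((k + 1).factorial : ℝ)) *
    OmegaF τ g (k + 1) (fun _ => 1 / (2 * u)), Finset.sum_mul]
  refine Finset.sum_congr rfl fun x hx => ?_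
  rw [mem_genusPairs] at hx
  have hx' : (n : ℝ) = 2 * x.1 + x.2 := by exact_mod_cast hx.symm
  rw [h.OmegaF_eq (N := N) (by omega) (by positivity), one_div (2 * u), Real.inv_rpow (by positivity),
    ← Real.rpow_neg (by positivity)]
  rw [show -(3 * ((x.1 : ℤ) : ℝ) - 3 + 3 * ((x.2 + 1 : ℕ) : ℝ) / 2) =
    -(3 * ((n : ℝ) - 1) / 2) by rw [hx']; push_cast; ring]
  ring

theorem hasDerivAt_const_mul_two_mul_rpow (C p : ℝ) {u : ℝ} (hu : 0 < u) :
    HasDerivAt (fun v => C * (2 * v) ^ p) (2 * p * C * (2 * u) ^ (p - 1)) u := by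
  have h1 := ((hasDerivAt_id u).const_mul 2).rpow_const (p := p)
    (Or.inl (by simpa using hu.ne'))
  rw [show 2 * p * C * (2 * u) ^ (p - 1) = C * (2 * 1 * p * (2 * id u) ^ (p - 1)) by
    rw [id]; ring]
  exact h1.const_mul C

theorem DVVFamily.deriv_Sfun (h : DVVFamily τ) {N n : ℕ} (hN : 2 * n + 1 ≤ N) {u : ℝ}
    (hu : 0 < u) :
    deriv (Sfun τ n) u = -wkbCoeff τ N n * (2 * u) ^ (-((3 * (n : ℝ) - 1) / 2)) := by
  have heq : Sfun τ n =ᶠ[nhds u] fun v =>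
      (∑ x ∈ genusPairs n, corrSum τ N x.1 (x.2 + 1) / ((x.2 + 1).factorial : ℝ)) *
      (2 * v) ^ (-(3 * ((n : ℝ) - 1) / 2)) :=
    (eventually_gt_nhds hu).mono fun v hv => h.Sfun_eq hN hv
  rw [heq.deriv_eq, (hasDerivAt_const_mul_two_mul_rpow _ _ hu).deriv, h.wkbCoeff_eq,
    show -(3 * ((n : ℝ) - 1) / 2) - 1 = -((3 * (n : ℝ) - 1) / 2) by ring]
  ring

theorem DVVFamily.deriv_deriv_Sfun (h : DVVFamily τ) {N n : ℕ} (hN : 2 * n + 1 ≤ N) {u : ℝ}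
    (hu : 0 < u) :
    deriv (deriv (Sfun τ n)) u =
      (3 * n - 1) * wkbCoeff τ N n * (2 * u) ^ (-((3 * (n : ℝ) + 1) / 2)) := by
  have heq : deriv (Sfun τ n) =ᶠ[nhds u] fun v =>
      -wkbCoeff τ N n * (2 * v) ^ (-((3 * (n : ℝ) - 1) / 2)) :=
    (eventually_gt_nhds hu).mono fun v hv => h.deriv_Sfun hN hv
  rw [heq.deriv_eq, (hasDerivAt_const_mul_two_mul_rpow _ _ hu).deriv,
    show -((3 * (n : ℝ) - 1) / 2) - 1 = -((3 * (n : ℝ) + 1) / 2) by ring]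
  ring

end

/-- The order-`ħⁿ` WKB equations for the quantum Airy curve (equation (5.13) of the paper):
`Sₙ' = (1/(2(2u)^{1/2})) (−S_{n-1}'' + S_{n-1}'/(2u) − Σ_{i+j=n, i,j≥2} Sᵢ'Sⱼ')`. -/
theorem S_WKB_recursion (τ : ℤ → (n : ℕ) → (Fin n → ℤ) → ℝ) (h : DVVFamily τ)
    (n : ℕ) (hn : 3 ≤ n) (u : ℝ) (hu : 0 < u) :
    deriv (Sfun τ n) u =
      (1 / (2 * (2 * u) ^ ((1 : ℝ) / 2))) *
        (- deriv (deriv (Sfun τ (n - 1))) u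
         + deriv (Sfun τ (n - 1)) u / (2 * u)
         - ∑ i ∈ Finset.range (n + 1),
             if 2 ≤ i ∧ 2 ≤ n - i then deriv (Sfun τ i) u * deriv (Sfun τ (n - i)) u else 0) := by
  have hN : ∀ m ≤ n, 2 * m + 1 ≤ 2 * n + 1 := fun m hm => by omega
  have hx : (0 : ℝ) < 2 * u := by positivity
  have hcast : ((n - 1 : ℕ) : ℝ) = n - 1 := by
    rw [Nat.cast_sub (by omega), Nat.cast_one]
  have hsum : ∀ i ∈ Finset.range (n + 1),
      (if 2 ≤ i ∧ 2 ≤ n - i then deriv (Sfun τ i) u * deriv (Sfun τ (n - i)) u else 0) =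
      (if 2 ≤ i ∧ 2 ≤ n - i then wkbCoeff τ (2 * n + 1) i * wkbCoeff τ (2 * n + 1) (n - i)
        else 0) * (2 * u) ^ (-((3 * (n : ℝ) - 2) / 2)) := by
    intro i hi
    rw [Finset.mem_range] at hi
    split_ifs
    · rw [h.deriv_Sfun (hN i (by omega)) hu, h.deriv_Sfun (hN (n - i) (by omega)) hu,
        Nat.cast_sub (by omega : i ≤ n), show -((3 * (n : ℝ) - 2) / 2) =
        -((3 * (i : ℝ) - 1) / 2) + -((3 * ((n : ℝ) - i) - 1) / 2) by ring, Real.rpow_add hx]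
      ring
    · simp
  have e1 : (2 * u) ^ (-((3 * ((n : ℝ) - 1) - 1) / 2)) =
      (2 * u) ^ (-((3 * (n : ℝ) - 2) / 2)) * (2 * u) := by
    nth_rewrite 3 [← Real.rpow_one (2 * u)]
    rw [← Real.rpow_add hx]
    congr 1
    ring
  have e2 : (2 * u) ^ (-((3 * ((n : ℝ) - 1) + 1) / 2)) = (2 * u) ^ (-((3 * (n : ℝ) - 2) / 2)) := by
    congr 1
    ring
  have e3 : (2 * u) ^ (-((3 * (n : ℝ) - 2) / 2)) =
      (2 * u) ^ (-((3 * (n : ℝ) - 1) / 2)) * (2 * u) ^ ((1 : ℝ) / 2) := by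
    rw [← Real.rpow_add hx]
    congr 1
    ring
  have hpow : (0 : ℝ) < (2 * u) ^ ((1 : ℝ) / 2) := Real.rpow_pos_of_pos hx _
  rw [Finset.sum_congr rfl hsum, ← Finset.sum_mul, h.deriv_Sfun (hN n le_rfl) hu,
    h.deriv_Sfun (hN (n - 1) (by omega)) hu, h.deriv_deriv_Sfun (hN (n - 1) (by omega)) hu, hcast,
    e1, e2, e3]
  have hrec := h.wkbCoeff_rec (2 * n + 1) n hn (by omega)
  field_simp
  linear_combination -hrec
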